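/- arXiv:1512.08319 — 18 statements merged into one kernel-verified Lean document; each statement's English description precedes it below -/
import Mathlib

section
/- For every real matrix A of size m × n there exists exactly one real matrix X of size n × m satisfying A * X * A = A, X * A * X = X, (A * X)ᵀ = A * X and (X * A)ᵀ = X * A (i.e., every real matrix has a unique Moore–Penrose inverse). -/
open Matrix

/-- Every linear map between vector spaces has an inner inverse. -/
theorem LinearMap.exists_inner_inverse {K V W : Type*} [DivisionRing K] [AddCommGroup V]
    [Module K V] [AddCommGroup W] [Module K W] (f : V →ₗ[K] W) :
    ∃ g : W →ₗ[K] V, f ∘ₗ g ∘ₗ f = f := by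
  obtain ⟨s, hs⟩ := f.rangeRestrict.exists_rightInverse_of_surjective f.range_rangeRestrict
  obtain ⟨g, hg⟩ := s.exists_extend
  refine ⟨g, LinearMap.ext fun x => ?_⟩
  have h₁ : g (f x) = s (f.rangeRestrict x) := LinearMap.congr_fun hg (f.rangeRestrict x)
  have h₂ := congrArg Subtype.val (LinearMap.congr_fun hs (f.rangeRestrict x))
  simpa [h₁] using h₂

namespace Matrix

variable {m n : Type*} [Fintype m] [Fintype n]

/-- Every matrix over a field has an inner inverse. -/
theorem exists_inner_inverse {K : Type*} [Field K] (A : Matrix m n K) :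
    ∃ G : Matrix n m K, A * G * A = A := by
  classical
  obtain ⟨g, hg⟩ := (toLin' A).exists_inner_inverse
  refine ⟨LinearMap.toMatrix' g, toLin'.injective ?_⟩
  rw [toLin'_mul, toLin'_mul, toLin'_toMatrix', LinearMap.comp_assoc, hg]

/-- Every real matrix has an inner inverse `Y` for which `A * Y` is symmetric. -/
theorem exists_inner_inverse_isSymm_mul (A : Matrix m n ℝ) :
    ∃ Y : Matrix n m ℝ, A * Y * A = A ∧ (A * Y)ᵀ = A * Y := by
  obtain ⟨G, hG⟩ := (Aᵀ * A).exists_inner_inverse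
  have hA : A * (G * Aᵀ) * A = A := by
    classical
    have h : Aᴴ * A * (G * Aᵀ * A - 1) = 0 := by
      rw [conjTranspose_eq_transpose_of_trivial, Matrix.mul_sub, Matrix.mul_one, sub_eq_zero]
      simpa only [Matrix.mul_assoc] using hG
    rw [conjTranspose_mul_self_mul_eq_zero, Matrix.mul_sub, Matrix.mul_one, sub_eq_zero] at h
    simpa only [Matrix.mul_assoc] using h
  have hP : A * (G * Aᵀ) * (A * (G * Aᵀ))ᵀ = (A * (G * Aᵀ))ᵀ := by
    have ht : (A * (G * Aᵀ))ᵀ = A * (Gᵀ * Aᵀ) := by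
      simp only [transpose_mul, transpose_transpose, Matrix.mul_assoc]
    rw [ht, ← Matrix.mul_assoc, hA]
  refine ⟨G * Aᵀ, hA, ?_⟩
  have h := congrArg transpose hP
  rw [transpose_mul, transpose_transpose, hP] at h
  exact h

/-- For inner inverses `X` and `Y` of `A` with `A * X` and `A * Y` symmetric, these products
agree. -/
theorem mul_eq_mul_of_inner_inverse_of_isSymm {R : Type*} [CommRing R] {A : Matrix m n R}
    {X Y : Matrix n m R} (hX : A * X * A = A) (hXs : (A * X)ᵀ = A * X)
    (hY : A * Y * A = A) (hYs : (A * Y)ᵀ = A * Y) : A * X = A * Y := by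
  calc A * X = (A * Y) * (A * X) := by rw [← Matrix.mul_assoc, hY]
    _ = ((A * X) * (A * Y))ᵀ := by rw [transpose_mul, hXs, hYs]
    _ = A * Y := by rw [← Matrix.mul_assoc, hX, hYs]

end Matrix

theorem moore_penrose_exists_unique (m n : ℕ) (A : Matrix (Fin m) (Fin n) ℝ) :
    ∃! X : Matrix (Fin n) (Fin m) ℝ,
      A * X * A = A ∧ X * A * X = X ∧ (A * X)ᵀ = A * X ∧ (X * A)ᵀ = X * A := by
  apply existsUnique_of_exists_of_unique
  · obtain ⟨Y, hY, hYs⟩ := A.exists_inner_inverse_isSymm_mul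
    obtain ⟨W, hW, hWs⟩ := Aᵀ.exists_inner_inverse_isSymm_mul
    obtain ⟨Z, rfl⟩ : ∃ Z, W = Zᵀ := ⟨Wᵀ, W.transpose_transpose.symm⟩
    have hZ : A * Z * A = A := by
      apply transpose_injective
      simpa only [transpose_mul, Matrix.mul_assoc] using hW
    have hZs : (Z * A)ᵀ = Z * A := by
      simpa only [transpose_mul, transpose_transpose] using hWs.symm
    have hAX : A * (Z * A * Y) = A * Y := by
      rw [← Matrix.mul_assoc, ← Matrix.mul_assoc, hZ]
    have hXA : Z * A * Y * A = Z * A := by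
      rw [Matrix.mul_assoc, Matrix.mul_assoc, ← Matrix.mul_assoc A, hY]
    refine ⟨Z * A * Y, ?_, ?_, ?_, ?_⟩
    · rw [hAX, hY]
    · rw [hXA, Matrix.mul_assoc, hAX, Matrix.mul_assoc]
    · rw [hAX, hYs]
    · rw [hXA, hZs]
  · rintro X Y ⟨hX, hX', hXl, hXr⟩ ⟨hY, hY', hYl, hYr⟩
    have hl : A * X = A * Y := mul_eq_mul_of_inner_inverse_of_isSymm hX hXl hY hYl
    have hr : X * A = Y * A := by
      apply transpose_injective
      rw [transpose_mul, transpose_mul]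
      apply mul_eq_mul_of_inner_inverse_of_isSymm
      · simpa only [transpose_mul, Matrix.mul_assoc] using congrArg transpose hX
      · rw [← transpose_mul, hXr, hXr]
      · simpa only [transpose_mul, Matrix.mul_assoc] using congrArg transpose hY
      · rw [← transpose_mul, hYr, hYr]
    rw [← hX', hr, Matrix.mul_assoc, hl, ← Matrix.mul_assoc, hY']
end

section
/- A square real matrix A of size n × n has at most one group inverse, and A has a group inverse if and only if rank(A) = rank(A * A). -/
/-- `X` is a group inverse of the square matrix `A`. -/
def IsGroupInverse {n : ℕ} (A X : Matrix (Fin n) (Fin n) ℝ) : Prop :=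
  A * X * A = A ∧ X * A * X = X ∧ A * X = X * A

/-- If right multiplication by `B` preserves the rank of `A`, it can be undone on `A`. -/
theorem Matrix.exists_eq_mul_mul_of_rank_eq {K l m n : Type*} [Field K] [Fintype l]
    [Fintype m] [Fintype n] [DecidableEq m] (A : Matrix l m K) (B : Matrix m n K)
    (h : A.rank = (A * B).rank) : ∃ U : Matrix n m K, A = A * B * U := by
  have hle : LinearMap.range (A * B).mulVecLin ≤ LinearMap.range A.mulVecLin := by
    rw [Matrix.mulVecLin_mul]
    exact LinearMap.range_comp_le_range _ _
  have hrange := Submodule.eq_of_le_of_finrank_eq hle h.symm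
  have hcol : ∀ j, ∃ u, (A * B).mulVec u = A.col j := fun j => by
    have hmem : A.col j ∈ LinearMap.range A.mulVecLin :=
      ⟨Pi.single j 1, by simp⟩
    rw [← hrange] at hmem
    simpa using hmem
  choose u hu using hcol
  refine ⟨Matrix.of fun i j => u j i, ?_⟩
  ext i j
  exact (congrFun (hu j) i).symm

theorem IsGroupInverse.eq {n : ℕ} {A X Y : Matrix (Fin n) (Fin n) ℝ}
    (hX : IsGroupInverse A X) (hY : IsGroupInverse A Y) : X = Y := by
  obtain ⟨hX₁, hX₂, hX₃⟩ := hX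
  obtain ⟨hY₁, hY₂, hY₃⟩ := hY
  have hproj : A * X = A * Y := calc
    A * X = A * Y * A * X := by rw [hY₁]
    _ = Y * (A * X * A) := by rw [hY₃, mul_assoc A X A, ← hX₃]; simp only [mul_assoc]
    _ = A * Y := by rw [hX₁, hY₃]
  calc
    X = A * X * X := by rw [hX₃, hX₂]
    _ = Y * (A * X) := by rw [← mul_assoc, ← hY₃, ← hproj]
    _ = Y := by rw [hproj, ← mul_assoc, hY₂]

theorem IsGroupInverse.rank_eq {n : ℕ} {A X : Matrix (Fin n) (Fin n) ℝ}
    (hX : IsGroupInverse A X) : A.rank = (A * A).rank := by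
  refine le_antisymm ?_ (Matrix.rank_mul_le_left A A)
  have hA : A = A * A * X := by rw [mul_assoc, hX.2.2, ← mul_assoc, hX.1]
  calc
    A.rank = (A * A * X).rank := by rw [← hA]
    _ ≤ (A * A).rank := Matrix.rank_mul_le_left _ _

theorem isGroupInverse_of_eq_mul {n : ℕ} {A U V : Matrix (Fin n) (Fin n) ℝ}
    (hU : A * A * U = A) (hV : V * (A * A) = A) : IsGroupInverse A (V * A * U) := by
  have hVU : V * A = A * U := calc
    V * A = V * (A * A * U) := by rw [hU]
    _ = A * U := by rw [← mul_assoc, hV]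
  have hleft : A * (V * A * U) = A * U := by
    rw [hVU, ← mul_assoc, ← mul_assoc, hU]
  have hright : V * A * U * A = V * A := by
    rw [mul_assoc V A U, ← hVU, mul_assoc, mul_assoc V A A, hV]
  refine ⟨?_, ?_, ?_⟩
  · rw [hleft, ← hVU, mul_assoc, hV]
  · rw [hright, mul_assoc V A (V * A * U), hleft, mul_assoc]
  · rw [hleft, hright, hVU]

theorem exists_isGroupInverse_of_rank_eq {n : ℕ} {A : Matrix (Fin n) (Fin n) ℝ}
    (h : A.rank = (A * A).rank) : ∃ X, IsGroupInverse A X := by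
  obtain ⟨U, hU⟩ := A.exists_eq_mul_mul_of_rank_eq A h
  obtain ⟨W, hW⟩ := A.transpose.exists_eq_mul_mul_of_rank_eq A.transpose (by
    rw [← Matrix.transpose_mul, Matrix.rank_transpose, Matrix.rank_transpose, h])
  refine ⟨_, isGroupInverse_of_eq_mul (V := W.transpose) hU.symm ?_⟩
  simpa using (congrArg Matrix.transpose hW).symm

theorem group_inverse_unique_and_exists_iff_rank (n : ℕ) (A : Matrix (Fin n) (Fin n) ℝ) :
    (∀ X Y : Matrix (Fin n) (Fin n) ℝ,
        IsGroupInverse A X → IsGroupInverse A Y → X = Y) ∧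
      ((∃ X : Matrix (Fin n) (Fin n) ℝ, IsGroupInverse A X) ↔ A.rank = (A * A).rank) :=
  ⟨fun _ _ hX hY => hX.eq hY, fun ⟨_, hX⟩ => hX.rank_eq, exists_isGroupInverse_of_rank_eq⟩
end

section
/- A square real matrix A of size n × n has a group inverse if and only if there exists a matrix X with A * A * X = A. Moreover, if A * A * X = A and Y is a group inverse of A, then Y = A * X * X. -/
/-- In a finite-dimensional algebra, if `a * a` and `a` generate the same right ideal, then
`a * a` and `a` have the same right annihilator. -/
theorem mul_eq_zero_of_mul_self_mul_eq {K R : Type*} [Field K] [Ring R] [Algebra K R]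
    [FiniteDimensional K R] {a x z : R} (hx : a * a * x = a) (hz : a * (a * z) = 0) :
    a * z = 0 := by
  let L := LinearMap.mulLeft K a
  let f : L.range →ₗ[K] L.range := L.restrict fun w _ => ⟨w, rfl⟩
  have hsurj : Function.Surjective f := by
    rintro ⟨_, w, rfl⟩
    refine ⟨⟨a * (x * w), x * w, rfl⟩, Subtype.ext ?_⟩
    change a * (a * (x * w)) = a * w
    rw [← mul_assoc, ← mul_assoc, hx]
  have hinj : Function.Injective f := LinearMap.injective_iff_surjective.mpr hsurj
  have hzero : (⟨a * z, z, rfl⟩ : L.range) = 0 :=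
    hinj ((Subtype.ext hz).trans (map_zero f).symm)
  exact congrArg Subtype.val hzero

/-- If `A * A * X = A`, then `A * X * X` is a group inverse of `A`. -/
theorem isGroupInverse_mul_mul {n : ℕ} {A X : Matrix (Fin n) (Fin n) ℝ} (hX : A * A * X = A) :
    IsGroupInverse A (A * X * X) := by
  have cancel {U V : Matrix (Fin n) (Fin n) ℝ} (h : A * A * U = A * A * V) : A * U = A * V := by
    rw [← sub_eq_zero, ← mul_sub]
    refine mul_eq_zero_of_mul_self_mul_eq (K := ℝ) hX ?_
    rw [← mul_assoc, mul_sub, h, sub_self]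
  have hAXA : A * X * A = A := by
    rw [mul_assoc, cancel (V := A * X), ← mul_assoc, hX]
    rw [← mul_assoc, hX, mul_assoc A A (A * X), ← mul_assoc A A X, hX]
  have hleft : A * (A * X * X) = A * X := by
    rw [← mul_assoc, ← mul_assoc, hX]
  have hright : A * X * X * A = A * X := by
    rw [mul_assoc, mul_assoc, cancel (V := X)]
    rw [← mul_assoc, hX, ← mul_assoc, hAXA]
  refine ⟨by rw [hleft, hAXA], ?_, hleft.trans hright.symm⟩
  rw [hright, ← mul_assoc, ← mul_assoc, hAXA]

/-- If `A * A * X = A`, then every group inverse of `A` equals `A * X * X`. -/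
theorem IsGroupInverse.eq_mul_mul {n : ℕ} {A X Y : Matrix (Fin n) (Fin n) ℝ}
    (hY : IsGroupInverse A Y) (hX : A * A * X = A) : Y = A * X * X := by
  obtain ⟨hAYA, hYAY, hcomm⟩ := hY
  have hYA : Y * A = A * X := by
    calc Y * A = Y * A * A * X := by rw [mul_assoc Y, mul_assoc Y, hX]
      _ = A * X := by rw [← hcomm, hAYA]
  calc Y = Y * (A * Y) := by rw [← mul_assoc, hYAY]
    _ = A * X * X := by rw [hcomm, hYA, ← mul_assoc, hYA]

theorem group_inverse_iff_and_formula (n : ℕ) (A : Matrix (Fin n) (Fin n) ℝ) :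
    ((∃ X : Matrix (Fin n) (Fin n) ℝ, IsGroupInverse A X) ↔
      ∃ X : Matrix (Fin n) (Fin n) ℝ, A * A * X = A) ∧
      (∀ X Y : Matrix (Fin n) (Fin n) ℝ, A * A * X = A → IsGroupInverse A Y →
        Y = A * X * X) := by
  refine ⟨⟨?_, ?_⟩, fun X Y hX hY => hY.eq_mul_mul hX⟩
  · rintro ⟨Y, hAYA, -, hcomm⟩
    exact ⟨Y, by rw [mul_assoc, hcomm, ← mul_assoc, hAYA]⟩
  · rintro ⟨X, hX⟩
    exact ⟨A * X * X, isGroupInverse_mul_mul hX⟩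
end

section
/- Let A be a real p × q matrix and B a real p × r matrix such that the column space of B is contained in the column space of A (i.e., the range of the linear map v ↦ B.mulVec v is contained in the range of v ↦ A.mulVec v). If X is a Moore–Penrose inverse of A and Y is a Moore–Penrose inverse of B, then (B * Y) * (A * X) = (A * X) * (B * Y) = B * Y. -/
open Matrix

/-- `X` is a Moore–Penrose inverse of `A`. -/
def IsMoorePenroseInverse {p q : ℕ} (A : Matrix (Fin p) (Fin q) ℝ)
    (X : Matrix (Fin q) (Fin p) ℝ) : Prop :=
  A * X * A = A ∧ X * A * X = X ∧ (A * X)ᵀ = A * X ∧ (X * A)ᵀ = X * A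

theorem mp_projection_range_inclusion (p q r : ℕ)
    (A : Matrix (Fin p) (Fin q) ℝ) (B : Matrix (Fin p) (Fin r) ℝ)
    (hrange : Set.range (fun v => B.mulVec v) ⊆ Set.range (fun v => A.mulVec v))
    (X : Matrix (Fin q) (Fin p) ℝ) (Y : Matrix (Fin r) (Fin p) ℝ)
    (hX : IsMoorePenroseInverse A X) (hY : IsMoorePenroseInverse B Y) :
    (B * Y) * (A * X) = B * Y ∧ (A * X) * (B * Y) = B * Y := by
  obtain ⟨hAXA, -, hAX, -⟩ := hX
  obtain ⟨-, -, hBY, -⟩ := hY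
  have hAXB : A * X * B = B := by
    refine Matrix.ext_of_mulVec_single fun i => ?_
    obtain ⟨w, hw⟩ := hrange ⟨Pi.single i 1, rfl⟩
    dsimp only at hw
    rw [← Matrix.mulVec_mulVec, ← hw, Matrix.mulVec_mulVec, hAXA]
  have hleft : A * X * (B * Y) = B * Y := by
    rw [← Matrix.mul_assoc, hAXB]
  refine ⟨?_, hleft⟩
  simpa only [Matrix.transpose_mul (A * X), hAX, hBY] using congrArg Matrix.transpose hleft
end

section
/- Fix n ≥ 1 and k : Fin n → ℕ with 2 ≤ k i for all i. For each finite set S ⊆ Fin n let E_S be the square real matrix indexed by strategy profiles (i : Fin n) → Fin (k i) whose (x, y) entry is 1 if x j = y j for all j ∉ S, and 0 otherwise. Then the family of matrices (E_S), indexed by all subsets S of Fin n, is linearly independent over ℝ. -/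
/-- The matrix `E_S`, indexed by strategy profiles, whose `(x, y)` entry is `1`
if `x j = y j` for all `j ∉ S`, and `0` otherwise. -/
def EMat (n : ℕ) (k : Fin n → ℕ) (S : Finset (Fin n)) :
    Matrix ((i : Fin n) → Fin (k i)) ((i : Fin n) → Fin (k i)) ℝ :=
  Matrix.of fun x y => if ∀ j ∉ S, x j = y j then (1 : ℝ) else 0

/-- The entry of `E_S` at two profiles that differ exactly on `T` detects whether `T ⊆ S`. -/
theorem EMat_apply_of_ne_iff_mem {n : ℕ} {k : Fin n → ℕ} {x y : (i : Fin n) → Fin (k i)}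
    {T : Finset (Fin n)} (hxy : ∀ j, x j ≠ y j ↔ j ∈ T) (S : Finset (Fin n)) :
    EMat n k S x y = if T ⊆ S then 1 else 0 := by
  have h : (∀ j ∉ S, x j = y j) ↔ T ⊆ S :=
    forall_congr' fun j => by rw [← hxy j, not_imp_comm]
  simp only [EMat, Matrix.of_apply, h]

/-- A function on finsets whose sums over all supersets vanish is zero. -/
theorem Finset.eq_zero_of_sum_superset_eq_zero {α M : Type*} [Fintype α] [DecidableEq α]
    [AddCommMonoid M] {g : Finset α → M}
    (hg : ∀ T : Finset α, ∑ S : Finset α, (if T ⊆ S then g S else 0) = 0) (T : Finset α) : g T = 0 := by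
  induction T using WellFoundedGT.induction with
  | ind T ih =>
    rw [← hg T, Finset.sum_eq_single T]
    · simp
    · intro S _ hST
      split_ifs with h
      · exact ih S (lt_of_le_of_ne h hST.symm)
      · rfl
    · simp

theorem EMat_linearIndependent (n : ℕ) (hn : 1 ≤ n) (k : Fin n → ℕ)
    (hk : ∀ i, 2 ≤ k i) :
    LinearIndependent ℝ (fun S : Finset (Fin n) => EMat n k S) := by
  rw [Fintype.linearIndependent_iff]
  intro g hg
  refine Finset.eq_zero_of_sum_superset_eq_zero fun T => ?_
  let x : (i : Fin n) → Fin (k i) := fun i => ⟨0, by have := hk i; omega⟩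
  let y : (i : Fin n) → Fin (k i) := fun i =>
    ⟨if i ∈ T then 1 else 0, by have := hk i; split_ifs <;> omega⟩
  have hxy : ∀ j, x j ≠ y j ↔ j ∈ T := fun j => by
    by_cases hj : j ∈ T <;> simp [x, y, hj]
  simpa [Matrix.sum_apply, EMat_apply_of_ne_iff_mem hxy] using congrFun (congrFun hg x) y
end

section
/- Fix n ≥ 1 and k : Fin n → ℕ with 2 ≤ k i for all i. Let A = Σ_{i : Fin n} (I − (1/(k i)) • E_{{i}}), where I is the identity matrix indexed by strategy profiles. Let X = Σ over all proper subsets S ⊊ Fin n of (1/((n − |S|) · (n choose |S|))) · (∏_{i ∈ S} 1/(k i)) • E_S − (Σ_{i=1}^{n} 1/i) · (∏_{i : Fin n} 1/(k i)) • E_{Fin n}. Then A * X * A = A, X * A * X = X, and A * X = X * A; that is, X is the group inverse of A. -/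
namespace GroupInverse

open Finset

/-- The averaging projection obtained by normalizing `E_S`. -/
noncomputable def avg (n : ℕ) (k : Fin n → ℕ) (S : Finset (Fin n)) :
    Matrix ((i : Fin n) → Fin (k i)) ((i : Fin n) → Fin (k i)) ℝ :=
  (∏ i ∈ S, (1 / (k i : ℝ))) • EMat n k S

lemma avg_apply (n : ℕ) (k : Fin n → ℕ) (S : Finset (Fin n)) (x y : (i : Fin n) → Fin (k i)) :
    avg n k S x y = ∏ j, if j ∈ S then 1 / (k j : ℝ) else if x j = y j then 1 else 0 := by
  rw [avg, Matrix.smul_apply, EMat, Matrix.of_apply, smul_eq_mul, prod_ite, prod_boole]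
  simp

lemma avg_empty (n : ℕ) (k : Fin n → ℕ) : avg n k ∅ = 1 := by
  ext x y
  simp [avg, EMat, Matrix.one_apply, funext_iff]

lemma avg_mul_avg (n : ℕ) (k : Fin n → ℕ) (hk : ∀ i, k i ≠ 0) (S T : Finset (Fin n)) :
    avg n k S * avg n k T = avg n k (S ∪ T) := by
  ext x y
  simp only [Matrix.mul_apply, avg_apply, ← prod_mul_distrib]
  rw [← Fintype.prod_sum (fun j (z : Fin (k j)) =>
    (if j ∈ S then 1 / (k j : ℝ) else if x j = z then 1 else 0) *
      (if j ∈ T then 1 / (k j : ℝ) else if z = y j then 1 else 0))]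
  refine prod_congr rfl fun j _ => ?_
  have hj : (k j : ℝ) ≠ 0 := by exact_mod_cast hk j
  by_cases hS : j ∈ S <;> by_cases hT : j ∈ T <;> simp [hS, hT, hj]

/-- The coefficient of a set of size `s` in the polynomial formula; it vanishes at `s = n`. -/
noncomputable def coeff (n s : ℕ) : ℝ := 1 / (((n - s) * n.choose s : ℕ) : ℝ)

lemma sub_mul_coeff {n s : ℕ} (h : s < n) :
    ((n - s : ℕ) : ℝ) * coeff n s = 1 / (n.choose s : ℝ) := by
  have h₁ : ((n - s : ℕ) : ℝ) ≠ 0 := by exact_mod_cast (Nat.sub_pos_of_lt h).ne'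
  have h₂ : (n.choose s : ℝ) ≠ 0 := by exact_mod_cast (Nat.choose_pos h.le).ne'
  rw [coeff, Nat.cast_mul]
  field_simp

lemma succ_mul_coeff {n s : ℕ} (h : s < n) :
    ((s + 1 : ℕ) : ℝ) * coeff n s = 1 / (n.choose (s + 1) : ℝ) := by
  have h₁ : ((n.choose (s + 1) : ℕ) : ℝ) ≠ 0 := by exact_mod_cast (Nat.choose_pos h).ne'
  have h₂ : ((s + 1 : ℕ) : ℝ) ≠ 0 := by exact_mod_cast s.succ_ne_zero
  rw [coeff, mul_comm (n - s), ← Nat.choose_succ_right_eq, Nat.cast_mul]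
  field_simp

lemma sum_coeff_card (n : ℕ) :
    ∑ S : Finset (Fin n), coeff n #S = ∑ i ∈ Icc 1 n, (1 : ℝ) / (i : ℝ) := by
  rw [← powerset_univ, sum_powerset_apply_card, card_fin, sum_range_succ]
  have h₀ : coeff n n = 0 := by simp [coeff]
  rw [h₀, smul_zero, add_zero]
  refine sum_nbij' (n - ·) (n - ·) ?_ ?_ ?_ ?_ fun s hs => ?_
  iterate 4 · intro s; simp only [mem_range, mem_Icc]; omega
  have hs : s < n := mem_range.1 hs
  have h₁ : (n.choose s : ℝ) ≠ 0 := by exact_mod_cast (Nat.choose_pos hs.le).ne'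
  rw [coeff, nsmul_eq_mul, Nat.cast_mul]
  field_simp

variable {R ι : Type*} [Ring R] [Algebra ℝ R] [Fintype ι] [DecidableEq ι]

lemma sum_insert_eq_sum_erase {M : Type*} [AddCommMonoid M] (f : Finset ι → Finset ι → M) (i : ι) :
    ∑ S with i ∉ S, f S (insert i S) = ∑ T with i ∈ T, f (T.erase i) T := by
  refine sum_nbij' (insert i) (fun T => T.erase i) ?_ ?_ ?_ ?_ ?_ <;> simp +contextual

/-- The telescoping identity behind the polynomial formula. -/
lemma sum_one_sub_mul_sum_coeff (P : Finset ι → R) (h₀ : P ∅ = 1)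
    (hP : ∀ S T, P S * P T = P (S ∪ T)) :
    (∑ i, (1 - P {i})) * ∑ S, coeff (Fintype.card ι) #S • P S = 1 - P univ := by
  set n := Fintype.card ι with hn
  have term (i : ι) (S : Finset ι) : (1 - P {i}) * (coeff n #S • P S) =
      if i ∉ S then coeff n #S • P S - coeff n #S • P (insert i S) else 0 := by
    rw [mul_smul_comm, sub_mul, one_mul, hP, singleton_union]
    split_ifs with h
    · rw [insert_eq_of_mem h, sub_self, smul_zero]
    · rw [smul_sub]
  have diag : ∑ i, ∑ S with i ∉ S, coeff n #S • P S =
      ∑ S, (1 / (n.choose #S : ℝ)) • P S - P univ := by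
    rw [eq_sub_iff_add_eq, ← sum_erase_add _ _ (mem_univ (univ : Finset ι))]
    simp only [sum_filter]
    rw [sum_comm, ← sum_erase_add _ _ (mem_univ (univ : Finset ι))]
    simp only [mem_univ, not_true, if_false, sum_const_zero, add_zero, card_univ, ← hn,
      Nat.choose_self, Nat.cast_one, div_one, one_smul]
    congr 1
    refine sum_congr rfl fun S hS => ?_
    have hlt : #S < n := (card_lt_iff_ne_univ S).2 (ne_of_mem_erase hS)
    rw [← sum_filter, sum_const, ← sub_mul_coeff hlt, mul_smul, ← Nat.cast_smul_eq_nsmul ℝ,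
      filter_not, filter_mem_eq_inter, univ_inter, card_univ_sdiff]
  have shift : ∑ i, ∑ S with i ∉ S, coeff n #S • P (insert i S) =
      ∑ S, (1 / (n.choose #S : ℝ)) • P S - 1 := by
    simp only [sum_insert_eq_sum_erase fun S T => coeff n #S • P T]
    rw [eq_sub_iff_add_eq, ← sum_erase_add _ _ (mem_univ (∅ : Finset ι))]
    simp only [sum_filter]
    rw [sum_comm, ← sum_erase_add _ _ (mem_univ (∅ : Finset ι))]
    simp only [notMem_empty, if_false, sum_const_zero, add_zero, card_empty,
      Nat.choose_zero_right, Nat.cast_one, div_one, one_smul, h₀]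
    congr 1
    refine sum_congr rfl fun T hT => ?_
    obtain ⟨s, hs⟩ := Nat.exists_eq_succ_of_ne_zero (card_ne_zero.2
      (nonempty_iff_ne_empty.2 (ne_of_mem_erase hT)))
    have hlt : s < n := by have := card_le_univ T; omega
    rw [← sum_filter, filter_mem_eq_inter, univ_inter, hs, Nat.succ_eq_add_one,
      ← succ_mul_coeff hlt, mul_smul, Nat.cast_smul_eq_nsmul ℝ, ← Nat.succ_eq_add_one, ← hs,
      ← sum_const]
    refine sum_congr rfl fun i hi => ?_
    rw [card_erase_of_mem hi, hs, Nat.succ_sub_one]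
  rw [sum_mul_sum]
  simp only [term, ← sum_filter]
  simp only [sum_sub_distrib, diag, shift]
  abel

end GroupInverse

open Finset GroupInverse in
theorem group_inverse_polynomial_formula (n : ℕ) (hn : 1 ≤ n) (k : Fin n → ℕ)
    (hk : ∀ i, 2 ≤ k i)
    (A X : Matrix ((i : Fin n) → Fin (k i)) ((i : Fin n) → Fin (k i)) ℝ)
    (hA : A = ∑ i : Fin n, ((1 : Matrix ((i : Fin n) → Fin (k i)) ((i : Fin n) → Fin (k i)) ℝ)
        - (1 / (k i : ℝ)) • EMat n k {i}))
    (hX : X = (∑ S ∈ Finset.univ.filter (fun S : Finset (Fin n) => S ≠ Finset.univ),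
          ((1 / (((n - S.card) * n.choose S.card : ℕ) : ℝ)) * ∏ i ∈ S, (1 / (k i : ℝ))) •
            EMat n k S)
        - ((∑ i ∈ Finset.Icc 1 n, (1 : ℝ) / (i : ℝ)) * ∏ i : Fin n, (1 / (k i : ℝ))) •
            EMat n k Finset.univ) :
    A * X * A = A ∧ X * A * X = X ∧ A * X = X * A := by
  have hk₀ i : k i ≠ 0 := by have := hk i; omega
  have hP := avg_mul_avg n k hk₀
  have hcomm S T : Commute (avg n k S) (avg n k T) := by
    rw [Commute, SemiconjBy, hP, hP, union_comm]
  set Q := avg n k univ with hQ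
  set H := ∑ i ∈ Icc 1 n, (1 : ℝ) / (i : ℝ)
  have hA' : A = ∑ i, (1 - avg n k {i}) := by simp [hA, avg]
  have hX' : X = ∑ S, coeff n #S • avg n k S - H • Q := by
    rw [hX, hQ, avg, smul_smul, sum_filter_of_ne]
    · simp only [avg, smul_smul, coeff]
    · rintro S - h rfl
      simp at h
  have hAQ : A * Q = 0 := by
    rw [hA', sum_mul]
    refine sum_eq_zero fun i _ => ?_
    rw [sub_mul, one_mul, hQ, hP, union_eq_right.2 (subset_univ _), sub_self]
  have hXQ : X * Q = 0 := by
    have hterm S : coeff n #S • avg n k S * Q = coeff n #S • Q := by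
      rw [smul_mul_assoc, hQ, hP, union_eq_right.2 (subset_univ _)]
    have hQQ : Q * Q = Q := by rw [hQ, hP, union_eq_right.2 (subset_univ _)]
    rw [hX', sub_mul, sum_mul, smul_mul_assoc, hQQ]
    simp only [hterm]
    rw [← sum_smul, sum_coeff_card, sub_self]
  have hAX : A * X = 1 - Q := by
    have h := sum_one_sub_mul_sum_coeff (avg n k) (avg_empty n k) hP
    rw [← hA', Fintype.card_fin] at h
    rw [hX', mul_sub, mul_smul_comm, hAQ, smul_zero, sub_zero, h]
  have hA_avg S : Commute A (avg n k S) := by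
    rw [hA']
    exact Commute.sum_left _ _ _ fun i _ => (Commute.one_left _).sub_left (hcomm _ _)
  have hAX_comm : Commute A X := by
    rw [hX']
    exact (Commute.sum_right _ _ _ fun S _ => (hA_avg S).smul_right _).sub_right
      ((hA_avg univ).smul_right _)
  refine ⟨?_, ?_, hAX_comm⟩
  · rw [hAX, sub_mul, one_mul, ← (hA_avg univ).eq, hAQ, sub_zero]
  · rw [mul_assoc, hAX, mul_sub, mul_one, hXQ, sub_zero]
end

section
/- Fix n ≥ 1 and k : Fin n → ℕ with 2 ≤ k i for all i. The nonstrategic games form a linear subspace of the game space, and its dimension (finrank over ℝ) equals Σ_{i : Fin n} ∏_{j ≠ i} k j. -/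
/-- A game is nonstrategic if each player's payoff does not depend on his own strategy. -/
def Nonstrategic {n : ℕ} {k : Fin n → ℕ}
    (c : Fin n → (((i : Fin n) → Fin (k i)) → ℝ)) : Prop :=
  ∀ (i : Fin n) (x : Fin (k i)) (s : (i : Fin n) → Fin (k i)),
    c i (Function.update s i x) = c i s

/-- Payoffs depending only on the opponents' strategies, regarded as a game. -/
def gameOfOpponentPayoffs {n : ℕ} (k : Fin n → ℕ) :
    ((i : Fin n) → ((j : {j // j ≠ i}) → Fin (k j)) → ℝ) →ₗ[ℝ]
      (Fin n → (((i : Fin n) → Fin (k i)) → ℝ)) where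
  toFun d i s := d i fun j => s j
  map_add' _ _ := rfl
  map_smul' _ _ := rfl

/-- Extend a profile of the opponents of player `i` by a strategy `x` of player `i`. -/
def extendProfile {n : ℕ} {k : Fin n → ℕ} (i : Fin n) (x : Fin (k i))
    (t : (j : {j // j ≠ i}) → Fin (k j)) : (j : Fin n) → Fin (k j) :=
  (Equiv.piSplitAt i fun j => Fin (k j)).symm (x, t)

theorem extendProfile_apply_coe {n : ℕ} {k : Fin n → ℕ} (i : Fin n) (x : Fin (k i))
    (t : (j : {j // j ≠ i}) → Fin (k j)) (j : {j // j ≠ i}) :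
    extendProfile i x t j = t j := by
  simp [extendProfile, Equiv.piSplitAt, j.2]

theorem extendProfile_restrict {n : ℕ} {k : Fin n → ℕ} (i : Fin n) (x : Fin (k i))
    (s : (j : Fin n) → Fin (k j)) :
    extendProfile i x (fun j => s j) = Function.update s i x := by
  funext j
  by_cases h : j = i
  · subst h
    simp [extendProfile, Equiv.piSplitAt]
  · simp [extendProfile, Equiv.piSplitAt, h]

theorem gameOfOpponentPayoffs_injective {n : ℕ} {k : Fin n → ℕ} (hk : ∀ i, 0 < k i) :
    Function.Injective (gameOfOpponentPayoffs k) := by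
  intro d e h
  funext i t
  have h' := congrFun (congrFun h i) (extendProfile i ⟨0, hk i⟩ t)
  simpa only [gameOfOpponentPayoffs, LinearMap.coe_mk, AddHom.coe_mk,
    extendProfile_apply_coe] using h'

theorem mem_range_gameOfOpponentPayoffs_iff {n : ℕ} {k : Fin n → ℕ} (hk : ∀ i, 0 < k i)
    (c : Fin n → (((i : Fin n) → Fin (k i)) → ℝ)) :
    c ∈ LinearMap.range (gameOfOpponentPayoffs k) ↔ Nonstrategic c := by
  constructor
  · rintro ⟨d, rfl⟩ i x s
    refine congrArg (d i) (funext fun j => ?_)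
    exact Function.update_of_ne j.2 x s
  · intro h
    refine ⟨fun i t => c i (extendProfile i ⟨0, hk i⟩ t), ?_⟩
    funext i s
    exact (congrArg (c i) (extendProfile_restrict i _ s)).trans (h i _ s)

theorem nonstrategic_subspace_dim (n : ℕ) (hn : 1 ≤ n) (k : Fin n → ℕ)
    (hk : ∀ i, 2 ≤ k i) :
    ∃ N : Submodule ℝ (Fin n → (((i : Fin n) → Fin (k i)) → ℝ)),
      (∀ c, c ∈ N ↔ Nonstrategic c) ∧
      Module.finrank ℝ N = ∑ i : Fin n, ∏ j ∈ Finset.univ.erase i, k j := by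
  have hpos : ∀ i, 0 < k i := fun i => two_pos.trans_le (hk i)
  refine ⟨LinearMap.range (gameOfOpponentPayoffs k),
    mem_range_gameOfOpponentPayoffs_iff hpos, ?_⟩
  rw [LinearMap.finrank_range_of_inj (gameOfOpponentPayoffs_injective hpos),
    Module.finrank_pi_fintype]
  refine Finset.sum_congr rfl fun i _ => ?_
  rw [Module.finrank_fintype_fun_eq_card, Fintype.card_pi]
  simp only [Fintype.card_fin]
  exact (Finset.prod_subtype _ (by simp) k).symm
end

section
/- Fix n ≥ 1 and k : Fin n → ℕ with 2 ≤ k i for all i. For any game c, define the game c' by c' i s = (1/(k i)) · Σ_{x : Fin (k i)} c i (x, s₋ᵢ). Then c' is nonstrategic, and c − c' is orthogonal to every nonstrategic game, i.e., ⟨c − c', d⟩ = 0 for every nonstrategic game d; hence c' is the orthogonal projection of c onto the subspace of nonstrategic games. -/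
/-- Summing `f` over all one-coordinate updates of all tuples counts every tuple once for each
value of that coordinate. -/
theorem Fintype.sum_sum_update {ι M : Type*} [Fintype ι] [DecidableEq ι] {α : ι → Type*}
    [∀ i, Fintype (α i)] [AddCommMonoid M] (i : ι) (f : (∀ j, α j) → M) :
    ∑ s : ∀ j, α j, ∑ x : α i, f (Function.update s i x) =
      Fintype.card (α i) • ∑ s : ∀ j, α j, f s := by
  have swap : Function.Involutive
      (fun p : (∀ j, α j) × α i => (Function.update p.1 i p.2, p.1 i)) := fun p => by simp
  calc ∑ s : ∀ j, α j, ∑ x : α i, f (Function.update s i x)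
      = ∑ p : (∀ j, α j) × α i, f (Function.update p.1 i p.2) :=
        (Fintype.sum_prod_type' fun s x => f (Function.update s i x)).symm
    _ = ∑ p : (∀ j, α j) × α i, f p.1 :=
        Fintype.sum_equiv swap.toPerm _ _ fun _ => rfl
    _ = Fintype.card (α i) • ∑ s : ∀ j, α j, f s := by
        simp [Fintype.sum_prod_type, Finset.smul_sum]

theorem projection_onto_nonstrategic (n : ℕ) (hn : 1 ≤ n) (k : Fin n → ℕ)
    (hk : ∀ i, 2 ≤ k i) (c : Fin n → (((i : Fin n) → Fin (k i)) → ℝ))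
    (c' : Fin n → (((i : Fin n) → Fin (k i)) → ℝ))
    (hc' : ∀ (i : Fin n) (s : (i : Fin n) → Fin (k i)),
      c' i s = (1 / (k i : ℝ)) * ∑ x : Fin (k i), c i (Function.update s i x)) :
    Nonstrategic c' ∧
      ∀ d : Fin n → (((i : Fin n) → Fin (k i)) → ℝ), Nonstrategic d →
        ∑ i : Fin n, ∑ s : (i : Fin n) → Fin (k i), (c i s - c' i s) * d i s = 0 := by
  refine ⟨fun i x s => by simp [hc'], fun d hd => Finset.sum_eq_zero fun i _ => ?_⟩
  have hki : (k i : ℝ) ≠ 0 := by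
    have := hk i
    positivity
  have sum_projection : ∑ s, c' i s * d i s = ∑ s, c i s * d i s :=
    calc ∑ s, c' i s * d i s
        = (1 / (k i : ℝ)) * ∑ s, ∑ x : Fin (k i),
            c i (Function.update s i x) * d i (Function.update s i x) := by
          simp only [hc', hd i, Finset.mul_sum, Finset.sum_mul, mul_assoc]
      _ = ∑ s, c i s * d i s := by
          rw [Fintype.sum_sum_update i fun s => c i s * d i s, Fintype.card_fin, nsmul_eq_mul]
          field_simp
  simp only [sub_mul, Finset.sum_sub_distrib, sum_projection, sub_self]
end

section
/- Fix n ≥ 1 and k : Fin n → ℕ with 2 ≤ k i for all i. A game c is orthogonal to every potential game (i.e., ⟨c, d⟩ = 0 for all potential games d) if and only if c is pure harmonic, that is: Σ_{i : Fin n} c i s = 0 for every profile s, and Σ_{x : Fin (k i)} c i (x, s₋ᵢ) = 0 for every i and every profile s. -/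
/-- A game is potential if it admits a potential function. -/
def IsPotentialGame {n : ℕ} {k : Fin n → ℕ}
    (c : Fin n → (((i : Fin n) → Fin (k i)) → ℝ)) : Prop :=
  ∃ φ : ((i : Fin n) → Fin (k i)) → ℝ,
    ∀ (i : Fin n) (x y : Fin (k i)) (s : (i : Fin n) → Fin (k i)),
      c i (Function.update s i x) - c i (Function.update s i y) =
        φ (Function.update s i x) - φ (Function.update s i y)

/-- A game is pure harmonic if payoffs sum to zero at every profile and each player's
payoffs sum to zero over his own unilateral deviations. -/
def PureHarmonic {n : ℕ} {k : Fin n → ℕ}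
    (c : Fin n → (((i : Fin n) → Fin (k i)) → ℝ)) : Prop :=
  (∀ s : (i : Fin n) → Fin (k i), ∑ i : Fin n, c i s = 0) ∧
  (∀ (i : Fin n) (s : (i : Fin n) → Fin (k i)),
    ∑ x : Fin (k i), c i (Function.update s i x) = 0)

/-- Summing over the profiles that agree with `t` away from player `i` amounts to summing over
the unilateral deviations of player `i` from `t`. -/
theorem sum_filter_update_eq {ι : Type*} [Fintype ι] [DecidableEq ι] {α : ι → Type*}
    [∀ i, Fintype (α i)] [∀ i, DecidableEq (α i)] {M : Type*} [AddCommMonoid M]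
    (f : (∀ i, α i) → M) (i : ι) (t : ∀ i, α i) :
    ∑ s with Function.update s i (t i) = t, f s = ∑ x, f (Function.update t i x) := by
  symm
  refine Finset.sum_bij' (fun x _ => Function.update t i x) (fun s _ => s i) ?_ ?_ ?_ ?_ ?_
  · simp
  · simp
  · simp
  · intro s hs
    rw [← (Finset.mem_filter.mp hs).2]
    simp
  · simp

/-- A function on profiles that sums to zero over the deviations of one player sums to zero. -/
theorem sum_eq_zero_of_sum_update_eq_zero {ι : Type*} [Fintype ι] [DecidableEq ι]
    {α : ι → Type*} [∀ i, Fintype (α i)] [∀ i, DecidableEq (α i)] {M : Type*} [AddCommMonoid M]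
    (f : (∀ i, α i) → M) (i : ι) (a : α i)
    (hf : ∀ t, ∑ x, f (Function.update t i x) = 0) : ∑ s, f s = 0 := by
  rw [← Finset.sum_fiberwise Finset.univ (fun s => Function.update s i a) f]
  refine Finset.sum_eq_zero fun t _ => ?_
  by_cases ht : t i = a
  · subst ht
    rw [sum_filter_update_eq, hf]
  · refine Finset.sum_eq_zero fun s hs => absurd ?_ ht
    rw [← (Finset.mem_filter.mp hs).2, Function.update_self]

theorem orthogonal_to_potential_iff_pure_harmonic (n : ℕ) (hn : 1 ≤ n)
    (k : Fin n → ℕ) (hk : ∀ i, 2 ≤ k i)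
    (c : Fin n → (((i : Fin n) → Fin (k i)) → ℝ)) :
    (∀ d : Fin n → (((i : Fin n) → Fin (k i)) → ℝ), IsPotentialGame d →
        ∑ i : Fin n, ∑ s : (i : Fin n) → Fin (k i), c i s * d i s = 0) ↔
      PureHarmonic c := by
  constructor
  · intro h
    refine ⟨fun t => ?_, fun i t => ?_⟩
    · simpa using h (fun _ s => if s = t then 1 else 0)
        ⟨fun s => if s = t then 1 else 0, fun _ _ _ _ => rfl⟩
    · have key := h (fun j s => if j = i then if Function.update s i (t i) = t then 1 else 0 else 0)
        ⟨0, fun j x y s => by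
          by_cases hj : j = i
          · subst hj
            simp
          · simp [hj]⟩
      rw [Finset.sum_eq_single i (fun j _ hj => by simp [hj]) (by simp)] at key
      rw [← sum_filter_update_eq (c i) i t, Finset.sum_filter]
      simpa using key
  · rintro ⟨hsum, hdev⟩ d ⟨φ, hφ⟩
    have hpot : ∑ i, ∑ s, c i s * φ s = 0 := by
      rw [Finset.sum_comm]
      simp [← Finset.sum_mul, hsum]
    have hrest : ∀ i, ∑ s, c i s * (d i s - φ s) = 0 := fun i => by
      refine sum_eq_zero_of_sum_update_eq_zero _ i ⟨0, by have := hk i; omega⟩ fun t => ?_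
      have hconst : ∀ x, d i (Function.update t i x) - φ (Function.update t i x) =
          d i t - φ t := fun x => by
        have := hφ i x (t i) t
        rw [Function.update_eq_self] at this
        linarith
      simp only [hconst, ← Finset.sum_mul, hdev, zero_mul]
    rw [← hpot]
    refine Finset.sum_congr rfl fun i _ => ?_
    rw [← sub_eq_zero, ← Finset.sum_sub_distrib, ← hrest i]
    exact Finset.sum_congr rfl fun s _ => (mul_sub _ _ _).symm
end

section
/- Fix n ≥ 1 and k : Fin n → ℕ with 2 ≤ k i for all i, and let K = ∏_{i} k i. The pure harmonic games form a linear subspace of the game space, and its dimension (finrank over ℝ) equals (n − 1)·K − Σ_{i : Fin n} ∏_{j ≠ i} k j + 1. -/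
section

variable {ι : Type*} [DecidableEq ι] {α : ι → Type*}

theorem piSplitAt_symm_restrict (i : ι) (s : (j : ι) → α j) (x : α i) :
    (Equiv.piSplitAt i α).symm (x, fun j => s j) = Function.update s i x := by
  ext j
  by_cases h : j = i
  · subst h; simp [Equiv.piSplitAt]
  · simp [Equiv.piSplitAt, h]

/-- A function on profiles invariant under unilateral deviations is constant. -/
theorem eq_of_forall_update_eq [Fintype ι] {β : Type*} (φ : ((j : ι) → α j) → β)
    (h : ∀ s i x, φ (Function.update s i x) = φ s) (s t : (j : ι) → α j) : φ s = φ t := by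
  suffices ∀ (S : Finset ι), φ (S.piecewise s t) = φ t by
    simpa using this Finset.univ
  intro S
  induction S using Finset.induction_on with
  | empty => simp
  | insert i S _ ih => rw [Finset.piecewise_insert, h, ih]

variable [∀ i, Fintype (α i)]

/-- Sum of a function on profiles over the `i`-th coordinate. -/
def coordSum (i : ι) :
    (((j : ι) → α j) → ℝ) →ₗ[ℝ] (((j : {j // j ≠ i}) → α j) → ℝ) where
  toFun f r := ∑ x : α i, f ((Equiv.piSplitAt i α).symm (x, r))
  map_add' f g := by ext r; simp [Finset.sum_add_distrib]
  map_smul' a f := by ext r; simp [Finset.mul_sum]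

theorem mem_ker_coordSum [∀ i, Nonempty (α i)] (i : ι) (f : ((j : ι) → α j) → ℝ) :
    f ∈ LinearMap.ker (coordSum (α := α) i) ↔
      ∀ s, ∑ x : α i, f (Function.update s i x) = 0 := by
  rw [LinearMap.mem_ker]
  constructor
  · intro h s
    have := congrFun h (fun j => s j)
    simpa [coordSum, piSplitAt_symm_restrict] using this
  · intro h
    ext r
    obtain ⟨y⟩ := ‹∀ i, Nonempty (α i)› i
    have h1 := h ((Equiv.piSplitAt i α).symm (y, r))
    have h2 : (fun j : {j // j ≠ i} => (Equiv.piSplitAt i α).symm (y, r) j) = r := by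
      ext j
      simp [Equiv.piSplitAt, j.2]
    simp_rw [← piSplitAt_symm_restrict, h2] at h1
    exact h1

theorem coordSum_surjective [∀ i, Nonempty (α i)] (i : ι) :
    Function.Surjective (coordSum (α := α) i) := by
  classical
  intro g
  obtain ⟨y⟩ := ‹∀ i, Nonempty (α i)› i
  refine ⟨fun s => if s i = y then g (fun j => s j) else 0, ?_⟩
  ext r
  have h (x : α i) : (fun j : {j // j ≠ i} => (Equiv.piSplitAt i α).symm (x, r) j) = r := by
    ext j
    simp [Equiv.piSplitAt, j.2]
  have h' (x : α i) : (Equiv.piSplitAt i α).symm (x, r) i = x := by simp [Equiv.piSplitAt]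
  simp only [coordSum, LinearMap.coe_mk, AddHom.coe_mk, h, h']
  simp

theorem coordSum_single (i : ι) [∀ i, DecidableEq (α i)] [DecidableEq ((j : ι) → α j)]
    [DecidableEq ((j : {j // j ≠ i}) → α j)] (s : (j : ι) → α j) :
    coordSum i (Pi.single s 1) = Pi.single (fun j : {j // j ≠ i} => s j) 1 := by
  ext r
  simp [coordSum, Pi.single_apply, Equiv.symm_apply_eq, Equiv.piSplitAt_apply,
    Prod.ext_iff, ite_and]

variable [Fintype ι]

theorem finrank_ker_coordSum [∀ i, Nonempty (α i)] (i : ι) :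
    (Module.finrank ℝ (LinearMap.ker (coordSum (α := α) i)) : ℤ) =
      ∏ j, (Fintype.card (α j) : ℤ) - ∏ j ∈ Finset.univ.erase i, (Fintype.card (α j) : ℤ) := by
  have h := LinearMap.finrank_range_add_finrank_ker (coordSum (α := α) i)
  rw [LinearMap.range_eq_top.2 (coordSum_surjective i), finrank_top,
    Module.finrank_fintype_fun_eq_card, Module.finrank_fintype_fun_eq_card, Fintype.card_pi, Fintype.card_pi] at h
  have h2 : ∏ j : {j // j ≠ i}, Fintype.card (α j) =
      ∏ j ∈ Finset.univ.erase i, Fintype.card (α j) :=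
    (Finset.prod_subtype _ (by simp) fun j => Fintype.card (α j)).symm
  rw [h2] at h
  zify at h
  linarith

/-- Summation over the players of a family of functions, the `i`-th of which has zero sum
along the `i`-th coordinate. -/
noncomputable def playerSum (α : ι → Type*) [∀ i, Fintype (α i)] :
    ((i : ι) → LinearMap.ker (coordSum (α := α) i)) →ₗ[ℝ] (((j : ι) → α j) → ℝ) :=
  ∑ i, (Submodule.subtype _).comp (LinearMap.proj i)

theorem playerSum_apply (w : (i : ι) → LinearMap.ker (coordSum (α := α) i)) :
    playerSum α w = ∑ i, (w i : ((j : ι) → α j) → ℝ) := by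
  simp [playerSum]

theorem ker_coordSum_le_range_playerSum (i : ι) :
    LinearMap.ker (coordSum (α := α) i) ≤ LinearMap.range (playerSum α) := by
  intro f hf
  refine ⟨Pi.single i ⟨f, hf⟩, ?_⟩
  rw [playerSum_apply, Finset.sum_eq_single i]
  · simp
  · intro j _ hj
    simp [hj]
  · simp

/-- Sum of a function over all profiles. -/
def totalSum (α : ι → Type*) [∀ i, Fintype (α i)] : (((j : ι) → α j) → ℝ) →ₗ[ℝ] ℝ :=
  ∑ s, LinearMap.proj s

theorem totalSum_apply (f : ((j : ι) → α j) → ℝ) : totalSum α f = ∑ s, f s := by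
  simp [totalSum]

theorem totalSum_eq_sum_coordSum (i : ι) (f : ((j : ι) → α j) → ℝ) :
    totalSum α f = ∑ r, coordSum i f r := by
  rw [totalSum_apply, ← (Equiv.piSplitAt i α).symm.sum_comp, Fintype.sum_prod_type_right]
  rfl

theorem range_playerSum [∀ i, Nonempty (α i)] :
    LinearMap.range (playerSum α) = LinearMap.ker (totalSum α) := by
  classical
  apply le_antisymm
  · rintro _ ⟨w, rfl⟩
    rw [LinearMap.mem_ker, playerSum_apply, map_sum]
    refine Finset.sum_eq_zero fun i _ => ?_
    rw [totalSum_eq_sum_coordSum i, LinearMap.mem_ker.1 (w i).2]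
    simp
  · intro f hf
    rw [LinearMap.mem_ker, totalSum_apply] at hf
    let q := (LinearMap.range (playerSum α)).mkQ
    let t : (j : ι) → α j := fun j => Classical.arbitrary _
    have hq (s : (j : ι) → α j) : q (Pi.single s 1) = q (Pi.single t 1) := by
      refine eq_of_forall_update_eq (fun s => q (Pi.single s (1 : ℝ))) (fun s i x => ?_) s t
      rw [← sub_eq_zero, ← map_sub, Submodule.mkQ_apply, Submodule.Quotient.mk_eq_zero]
      apply ker_coordSum_le_range_playerSum i
      rw [LinearMap.mem_ker, map_sub, coordSum_single, coordSum_single, sub_eq_zero]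
      congr 1
      ext j
      rw [Function.update_of_ne j.2]
    have hsum : f = ∑ s, f s • (Pi.single s 1 : ((j : ι) → α j) → ℝ) := by
      simpa using pi_eq_sum_univ' f
    rw [← Submodule.Quotient.mk_eq_zero, ← Submodule.mkQ_apply]
    change q f = 0
    rw [hsum, map_sum]
    simp_rw [map_smul, hq, ← Finset.sum_smul, hf, zero_smul]

theorem finrank_ker_totalSum [∀ i, Nonempty (α i)] :
    (Module.finrank ℝ (LinearMap.ker (totalSum α)) : ℤ) =
      ∏ j, (Fintype.card (α j) : ℤ) - 1 := by
  classical
  have hs : Function.Surjective (totalSum α) := fun a =>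
    ⟨Pi.single (fun j => Classical.arbitrary _) a, by simp [totalSum_apply]⟩
  have h := LinearMap.finrank_range_add_finrank_ker (totalSum α)
  rw [LinearMap.range_eq_top.2 hs, finrank_top, Module.finrank_fintype_fun_eq_card,
    Fintype.card_pi, Module.finrank_self] at h
  zify at h
  linarith

theorem finrank_ker_playerSum [∀ i, Nonempty (α i)] :
    (Module.finrank ℝ (LinearMap.ker (playerSum α)) : ℤ) =
      ((Fintype.card ι : ℤ) - 1) * ∏ j, (Fintype.card (α j) : ℤ)
        - ∑ i, ∏ j ∈ Finset.univ.erase i, (Fintype.card (α j) : ℤ) + 1 := by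
  have h := LinearMap.finrank_range_add_finrank_ker (playerSum α)
  rw [range_playerSum, Module.finrank_pi_fintype] at h
  zify at h
  simp_rw [finrank_ker_totalSum, finrank_ker_coordSum, Finset.sum_sub_distrib] at h
  simp only [Finset.sum_const, Finset.card_univ, nsmul_eq_mul] at h
  linarith

end

theorem pure_harmonic_subspace_dim (n : ℕ) (hn : 1 ≤ n) (k : Fin n → ℕ)
    (hk : ∀ i, 2 ≤ k i) :
    ∃ H : Submodule ℝ (Fin n → (((i : Fin n) → Fin (k i)) → ℝ)),
      (∀ c, c ∈ H ↔ PureHarmonic c) ∧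
      (Module.finrank ℝ H : ℤ) =
        ((n : ℤ) - 1) * (∏ i : Fin n, (k i : ℤ))
          - (∑ i : Fin n, ∏ j ∈ Finset.univ.erase i, (k j : ℤ)) + 1 := by
  have (i : Fin n) : Nonempty (Fin (k i)) := ⟨⟨0, by have := hk i; omega⟩⟩
  let α : Fin n → Type := fun i => Fin (k i)
  let e : ((i : Fin n) → LinearMap.ker (coordSum (α := α) i)) →ₗ[ℝ]
      (Fin n → (((i : Fin n) → Fin (k i)) → ℝ)) :=
    LinearMap.pi fun i => (Submodule.subtype _).comp (LinearMap.proj i)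
  have he : Function.Injective e := fun v w h => by
    ext1 i
    exact Subtype.ext (congrFun h i)
  refine ⟨(LinearMap.ker (playerSum α)).map e, fun c => ?_, ?_⟩
  · constructor
    · rintro ⟨w, hw, rfl⟩
      refine ⟨fun s => ?_, fun i => (mem_ker_coordSum i _).1 (w i).2⟩
      rw [SetLike.mem_coe, LinearMap.mem_ker, playerSum_apply] at hw
      simpa [e] using congrFun hw s
    · rintro ⟨h0, h⟩
      refine ⟨fun i => ⟨c i, (mem_ker_coordSum (α := α) i _).2 (h i)⟩, ?_, rfl⟩
      rw [SetLike.mem_coe, LinearMap.mem_ker, playerSum_apply]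
      ext s
      simpa using h0 s
  · rw [← (Submodule.equivMapOfInjective e he _).finrank_eq, finrank_ker_playerSum]
    simp [α]
end

section
/- Fix n ≥ 1 and k : Fin n → ℕ with 2 ≤ k i for all i. Let c be a pure harmonic game and let s* be a pure Nash equilibrium of c. Then for every player i and every x : Fin (k i), c i (x, s*₋ᵢ) = 0. -/
/-- `s*` is a pure Nash equilibrium of `c`. -/
def IsPureNash {n : ℕ} {k : Fin n → ℕ}
    (c : Fin n → (((i : Fin n) → Fin (k i)) → ℝ))
    (sstar : (i : Fin n) → Fin (k i)) : Prop :=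
  ∀ (i : Fin n) (x : Fin (k i)), c i (Function.update sstar i x) ≤ c i sstar

theorem pure_harmonic_nash_payoffs_zero (n : ℕ) (hn : 1 ≤ n) (k : Fin n → ℕ)
    (hk : ∀ i, 2 ≤ k i) (c : Fin n → (((i : Fin n) → Fin (k i)) → ℝ))
    (hc : PureHarmonic c) (sstar : (i : Fin n) → Fin (k i))
    (hnash : IsPureNash c sstar) :
    ∀ (i : Fin n) (x : Fin (k i)), c i (Function.update sstar i x) = 0 := by
  have nonneg : ∀ i, 0 ≤ c i sstar := by
    intro i
    by_contra! hneg
    have hlt : ∑ x : Fin (k i), c i (Function.update sstar i x) < 0 :=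
      Finset.sum_neg (fun x _ => (hnash i x).trans_lt hneg) ⟨sstar i, Finset.mem_univ _⟩
    exact hlt.ne (hc.2 i sstar)
  have payoff_zero : ∀ i, c i sstar = 0 := fun i =>
    (Finset.sum_eq_zero_iff_of_nonneg fun j _ => nonneg j).1 (hc.1 sstar) i (Finset.mem_univ i)
  intro i x
  exact (Finset.sum_eq_zero_iff_of_nonpos fun y _ => (hnash i y).trans_eq (payoff_zero i)).1
    (hc.2 i sstar) x (Finset.mem_univ x)
end

section
/- Fix n ≥ 2 and k : Fin n → ℕ with 2 ≤ k i for all i, and let K = ∏_{i} k i. For any fixed profile s*, the set G_{s*} of pure harmonic games having s* as a pure Nash equilibrium is a linear subspace of the game space, and its dimension (finrank over ℝ) is strictly less than the dimension of the subspace of pure harmonic games, i.e., finrank(G_{s*}) < (n − 1)·K − Σ_{i : Fin n} ∏_{j ≠ i} k j + 1. -/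
namespace PureHarmonic

variable {n : ℕ} {k : Fin n → ℕ}

/-- A profile is a pure Nash equilibrium of a pure harmonic game exactly when each player's payoff
vanishes at all of that player's deviations from it. -/
theorem isPureNash_iff {c : Fin n → (((i : Fin n) → Fin (k i)) → ℝ)} (hc : PureHarmonic c)
    (s : (i : Fin n) → Fin (k i)) :
    IsPureNash c s ↔ ∀ (i : Fin n) (x : Fin (k i)), c i (Function.update s i x) = 0 := by
  constructor
  · intro h
    have hnonneg : ∀ i, 0 ≤ c i s := by
      intro i
      by_contra! hneg
      have hlt : ∑ x : Fin (k i), c i (Function.update s i x) < 0 :=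
        Finset.sum_neg (fun x _ => (h i x).trans_lt hneg) ⟨s i, Finset.mem_univ _⟩
      exact hlt.ne (hc.2 i s)
    have hzero : ∀ i, c i s = 0 := fun i =>
      (Finset.sum_eq_zero_iff_of_nonneg fun i _ => hnonneg i).1 (hc.1 s) i (Finset.mem_univ i)
    intro i x
    exact (Finset.sum_eq_zero_iff_of_nonpos fun y _ => (h i y).trans (hzero i).le).1
      (hc.2 i s) x (Finset.mem_univ x)
  · intro h i x
    have hs := h i (s i)
    rw [Function.update_eq_self] at hs
    rw [h i x, hs]

/-- A two-player zero-sum product game shows that payoffs of pure harmonic games need not vanish. -/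
theorem exists_payoff_ne_zero (hk : ∀ i, 2 ≤ k i) {p q : Fin n} (hpq : p ≠ q)
    (s : (i : Fin n) → Fin (k i)) :
    ∃ c : Fin n → (((i : Fin n) → Fin (k i)) → ℝ), PureHarmonic c ∧ c p s ≠ 0 := by
  let φ : (i : Fin n) → Fin (k i) → ℝ := fun i x => (if x = s i then (k i : ℝ) else 0) - 1
  have hφ : ∀ i, ∑ x, φ i x = 0 := fun i => by simp [φ]
  have hφs : ∀ i, φ i (s i) ≠ 0 := fun i => by
    have h : (2 : ℝ) ≤ k i := by exact_mod_cast hk i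
    simp only [φ, if_true]
    linarith
  refine ⟨fun i t => ((if i = p then 1 else 0) - (if i = q then 1 else 0)) *
    (φ p (t p) * φ q (t q)), ⟨fun t => ?_, fun i t => ?_⟩, ?_⟩
  · rw [← Finset.sum_mul]
    simp
  · rw [← Finset.mul_sum]
    by_cases hip : i = p
    · subst hip
      simp [Function.update_of_ne hpq.symm, ← Finset.sum_mul, hφ]
    · by_cases hiq : i = q
      · subst hiq
        simp [Function.update_of_ne hpq, ← Finset.mul_sum, hφ]
      · simp [hip, hiq]
  · simpa [hpq] using ⟨hφs p, hφs q⟩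

/-- The sums of all players' payoffs over their own strategies. -/
def deviationSum (k : Fin n → ℕ) : (Fin n → (((i : Fin n) → Fin (k i)) → ℝ)) →ₗ[ℝ]
    ((i : Fin n) → (((j : {j // j ≠ i}) → Fin (k j)) → ℝ)) where
  toFun c i t := ∑ x : Fin (k i), c i ((Equiv.piSplitAt i fun j => Fin (k j)).symm (x, t))
  map_add' c d := by ext; simp [Finset.sum_add_distrib]
  map_smul' a c := by ext; simp [Finset.mul_sum]

theorem piSplitAt_symm_restrict (i : Fin n) (s : (i : Fin n) → Fin (k i)) (x : Fin (k i)) :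
    (Equiv.piSplitAt i fun j => Fin (k j)).symm (x, fun j => s j) = Function.update s i x := by
  ext j
  by_cases h : j = i
  · subst h; simp
  · simp [h]

theorem mem_ker_deviationSum {c : Fin n → (((i : Fin n) → Fin (k i)) → ℝ)} :
    c ∈ LinearMap.ker (deviationSum k) ↔ ∀ (i : Fin n) (s : (i : Fin n) → Fin (k i)),
      ∑ x : Fin (k i), c i (Function.update s i x) = 0 := by
  rw [LinearMap.mem_ker]
  constructor
  · intro h i s
    simpa [deviationSum, piSplitAt_symm_restrict] using congrFun (congrFun h i) fun j => s j
  · intro h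
    ext i t
    by_cases hi : Nonempty (Fin (k i))
    · obtain ⟨y⟩ := hi
      have ht : t = fun j : {j // j ≠ i} =>
          (Equiv.piSplitAt i fun j => Fin (k j)).symm (y, t) j := by
        ext j
        simp [j.2]
      rw [ht]
      simpa only [deviationSum, LinearMap.coe_mk, AddHom.coe_mk, piSplitAt_symm_restrict,
        Pi.zero_apply] using h i _
    · have := not_nonempty_iff.1 hi
      simp [deviationSum]

theorem deviationSum_surjective (s : (i : Fin n) → Fin (k i)) :
    Function.Surjective (deviationSum k) := by
  intro g
  refine ⟨fun i t => if t i = s i then g i fun j => t j else 0, ?_⟩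
  ext i t
  have ht : ∀ x : Fin (k i), (fun j : {j // j ≠ i} =>
      (Equiv.piSplitAt i fun j => Fin (k j)).symm (x, t) j) = t := by
    intro x
    ext j
    simp [j.2]
  simp only [deviationSum, LinearMap.coe_mk, AddHom.coe_mk, ht]
  simp

theorem finrank_ker_deviationSum (s : (i : Fin n) → Fin (k i)) :
    (Module.finrank ℝ (LinearMap.ker (deviationSum k)) : ℤ) =
      n * (∏ i : Fin n, (k i : ℤ)) - ∑ i : Fin n, ∏ j ∈ Finset.univ.erase i, (k j : ℤ) := by
  have h := (deviationSum k).finrank_range_add_finrank_ker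
  rw [LinearMap.range_eq_top.2 (deviationSum_surjective s), finrank_top,
    Module.finrank_pi_fintype, Module.finrank_pi_fintype] at h
  simp only [Module.finrank_fintype_fun_eq_card, Fintype.card_pi, Fintype.card_fin,
    Finset.sum_const, Finset.card_univ, smul_eq_mul] at h
  have hprod : ∀ i : Fin n, ∏ j : {j // j ≠ i}, k j = ∏ j ∈ Finset.univ.erase i, k j :=
    fun i => (Finset.prod_subtype _ (by simp) _).symm
  simp only [hprod] at h
  zify at h
  linarith

/-- The sum of all payoffs, on games whose payoffs sum to zero over own deviations. -/
def payoffSum (k : Fin n → ℕ) :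
    LinearMap.ker (deviationSum k) →ₗ[ℝ] (((i : Fin n) → Fin (k i)) → ℝ) :=
  (∑ i : Fin n, LinearMap.proj i).domRestrict _

theorem payoffSum_apply (c : LinearMap.ker (deviationSum k)) (s : (i : Fin n) → Fin (k i)) :
    payoffSum k c s = ∑ i, c.1 i s := by
  simp [payoffSum]

theorem sum_single_update (i : Fin n) (s t : (i : Fin n) → Fin (k i)) :
    ∑ x : Fin (k i), (Pi.single s 1 : ((i : Fin n) → Fin (k i)) → ℝ) (Function.update t i x) =
      if ∀ j ≠ i, t j = s j then 1 else 0 := by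
  have h : ∀ x, (Pi.single s 1 : ((i : Fin n) → Fin (k i)) → ℝ) (Function.update t i x) =
      if x = s i then (if ∀ j ≠ i, t j = s j then 1 else 0) else 0 := by
    intro x
    rw [Pi.single_apply, ← ite_and]
    simp only [Function.update_eq_iff]
  simp [h]

theorem single_update_sub_single_mem_range (i : Fin n) (s : (i : Fin n) → Fin (k i))
    (x : Fin (k i)) :
    (Pi.single (Function.update s i x) 1 - Pi.single s 1 : ((i : Fin n) → Fin (k i)) → ℝ) ∈
      LinearMap.range (payoffSum k) := by
  let c : Fin n → (((i : Fin n) → Fin (k i)) → ℝ) :=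
    Pi.single i (Pi.single (Function.update s i x) 1 - Pi.single s 1)
  have hc : c ∈ LinearMap.ker (deviationSum k) := by
    rw [mem_ker_deviationSum]
    intro j t
    by_cases hj : j = i
    · subst hj
      have hagree : (∀ l ≠ j, t l = Function.update s j x l) ↔ ∀ l ≠ j, t l = s l :=
        forall₂_congr fun l hl => by rw [Function.update_of_ne hl]
      simp only [c, Pi.single_eq_same, Pi.sub_apply, Finset.sum_sub_distrib, sum_single_update,
        hagree, sub_self]
    · simp [c, hj]
  refine ⟨⟨c, hc⟩, ?_⟩
  ext t
  rw [payoffSum_apply, Finset.sum_eq_single i]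
  · simp [c]
  · intro j _ hj
    simp [c, hj]
  · simp

theorem single_sub_single_mem_range (s t : (i : Fin n) → Fin (k i)) :
    (Pi.single t 1 - Pi.single s 1 : ((i : Fin n) → Fin (k i)) → ℝ) ∈
      LinearMap.range (payoffSum k) := by
  have h : ∀ T : Finset (Fin n),
      (Pi.single (T.piecewise t s) 1 - Pi.single s 1 : ((i : Fin n) → Fin (k i)) → ℝ) ∈
        LinearMap.range (payoffSum k) := by
    intro T
    induction T using Finset.induction_on with
    | empty => simp
    | insert j T _ ih =>
      rw [Finset.piecewise_insert]
      have := add_mem (single_update_sub_single_mem_range j (T.piecewise t s) (t j)) ih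
      rwa [sub_add_sub_cancel] at this
  simpa using h Finset.univ

theorem prod_le_finrank_range_payoffSum_add_one (s : (i : Fin n) → Fin (k i)) :
    ∏ i, k i ≤ Module.finrank ℝ (LinearMap.range (payoffSum k)) + 1 := by
  let e : ((i : Fin n) → Fin (k i)) → ℝ := Pi.single s 1
  have htop : LinearMap.range (payoffSum k) ⊔ ℝ ∙ e = ⊤ := by
    rw [eq_top_iff]
    intro f _
    rw [← (Pi.basisFun ℝ ((i : Fin n) → Fin (k i))).sum_repr f]
    refine sum_mem fun t _ => Submodule.smul_mem _ _ ?_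
    rw [Pi.basisFun_apply, ← sub_add_cancel (Pi.single t 1) e]
    exact add_mem (Submodule.mem_sup_left (single_sub_single_mem_range s t))
      (Submodule.mem_sup_right (Submodule.mem_span_singleton_self e))
  have hdim := Submodule.finrank_add_le_finrank_add_finrank (LinearMap.range (payoffSum k)) (ℝ ∙ e)
  rw [htop, finrank_top, Module.finrank_fintype_fun_eq_card, Fintype.card_pi] at hdim
  simp only [Fintype.card_fin] at hdim
  have hspan : Module.finrank ℝ (ℝ ∙ e) ≤ 1 := by
    simpa using finrank_span_le_card (R := ℝ) ({e} : Set (((i : Fin n) → Fin (k i)) → ℝ))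
  omega

/-- The subspace of pure harmonic games. -/
def submodule (k : Fin n → ℕ) : Submodule ℝ (Fin n → (((i : Fin n) → Fin (k i)) → ℝ)) :=
  (LinearMap.ker (payoffSum k)).map (LinearMap.ker (deviationSum k)).subtype

theorem mem_submodule {c : Fin n → (((i : Fin n) → Fin (k i)) → ℝ)} :
    c ∈ submodule k ↔ PureHarmonic c := by
  simp only [submodule, Submodule.mem_map, LinearMap.mem_ker, Submodule.subtype_apply,
    Subtype.exists, exists_and_right, exists_eq_right, funext_iff (f := payoffSum k _),
    payoffSum_apply, Pi.zero_apply]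
  rw [exists_prop, ← LinearMap.mem_ker, mem_ker_deviationSum, and_comm]
  rfl

theorem finrank_submodule_le (s : (i : Fin n) → Fin (k i)) :
    (Module.finrank ℝ (submodule k) : ℤ) ≤ ((n : ℤ) - 1) * (∏ i : Fin n, (k i : ℤ))
      - (∑ i : Fin n, ∏ j ∈ Finset.univ.erase i, (k j : ℤ)) + 1 := by
  rw [submodule, Submodule.finrank_map_subtype_eq]
  have hrank := (payoffSum k).finrank_range_add_finrank_ker
  have hrange := prod_le_finrank_range_payoffSum_add_one s
  have hker := finrank_ker_deviationSum s
  zify at hrank hrange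
  linarith

end PureHarmonic

theorem pure_harmonic_with_nash_small_dim (n : ℕ) (hn : 2 ≤ n) (k : Fin n → ℕ)
    (hk : ∀ i, 2 ≤ k i) (sstar : (i : Fin n) → Fin (k i)) :
    ∃ G : Submodule ℝ (Fin n → (((i : Fin n) → Fin (k i)) → ℝ)),
      (∀ c, c ∈ G ↔ PureHarmonic c ∧ IsPureNash c sstar) ∧
      (Module.finrank ℝ G : ℤ) <
        ((n : ℤ) - 1) * (∏ i : Fin n, (k i : ℤ))
          - (∑ i : Fin n, ∏ j ∈ Finset.univ.erase i, (k j : ℤ)) + 1 := by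
  let G : Submodule ℝ (Fin n → (((i : Fin n) → Fin (k i)) → ℝ)) :=
    { carrier := {c | c ∈ PureHarmonic.submodule k ∧
        ∀ (i : Fin n) (x : Fin (k i)), c i (Function.update sstar i x) = 0}
      zero_mem' := ⟨zero_mem _, fun _ _ => rfl⟩
      add_mem' := fun hc hd => ⟨add_mem hc.1 hd.1, fun i x => by simp [hc.2 i x, hd.2 i x]⟩
      smul_mem' := fun a _ hc => ⟨Submodule.smul_mem _ a hc.1, fun i x => by simp [hc.2 i x]⟩ }
  refine ⟨G, fun c => ?_, ?_⟩
  · change (c ∈ PureHarmonic.submodule k ∧ _) ↔ _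
    rw [PureHarmonic.mem_submodule]
    exact and_congr_right fun hc => (PureHarmonic.isPureNash_iff hc sstar).symm
  · have hpq : (⟨0, by omega⟩ : Fin n) ≠ ⟨1, by omega⟩ := by simp
    obtain ⟨c, hc, hne⟩ := PureHarmonic.exists_payoff_ne_zero hk hpq sstar
    have hlt : G < PureHarmonic.submodule k := by
      refine lt_of_le_of_ne (fun d hd => hd.1) fun heq => hne ?_
      have hcG : c ∈ G := heq ▸ PureHarmonic.mem_submodule.2 hc
      simpa using hcG.2 ⟨0, by omega⟩ (sstar ⟨0, by omega⟩)
    exact lt_of_lt_of_le (by exact_mod_cast Submodule.finrank_lt_finrank_of_lt hlt)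
      (PureHarmonic.finrank_submodule_le sstar)
end

section
/- Let n = 2 and k i = 2 for both players (2 × 2 games). If c is a pure harmonic game that has a pure Nash equilibrium, then c is the zero game: c i s = 0 for all players i and all profiles s. -/
/-- A `2 × 2` game is pure harmonic if payoffs sum to zero at every profile and each
player's payoffs sum to zero over his own unilateral deviations. -/
def PureHarmonic2 (c : Fin 2 → ((Fin 2 → Fin 2) → ℝ)) : Prop :=
  (∀ s : Fin 2 → Fin 2, ∑ i : Fin 2, c i s = 0) ∧
  (∀ (i : Fin 2) (s : Fin 2 → Fin 2),
    ∑ x : Fin 2, c i (Function.update s i x) = 0)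

/-- `s*` is a pure Nash equilibrium of the `2 × 2` game `c`. -/
def IsPureNash2 (c : Fin 2 → ((Fin 2 → Fin 2) → ℝ)) (sstar : Fin 2 → Fin 2) : Prop :=
  ∀ (i : Fin 2) (x : Fin 2), c i (Function.update sstar i x) ≤ c i sstar

/-- In a pure harmonic game, every payoff at a pure Nash equilibrium vanishes. -/
lemma PureHarmonic2.eq_zero_of_isPureNash2 {c : Fin 2 → ((Fin 2 → Fin 2) → ℝ)}
    (hc : PureHarmonic2 c) {s : Fin 2 → Fin 2} (hs : IsPureNash2 c s) (i : Fin 2) :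
    c i s = 0 := by
  have nonneg (j : Fin 2) : 0 ≤ c j s := by
    have h := Finset.sum_le_sum fun x (_ : x ∈ Finset.univ) => hs j x
    rw [hc.2 j s] at h
    simpa using h
  exact (Finset.sum_eq_zero_iff_of_nonneg fun j _ => nonneg j).1 (hc.1 s) i (Finset.mem_univ i)

/-- In a pure harmonic game, vanishing of all payoffs at a profile is preserved by
unilateral deviations. -/
lemma PureHarmonic2.update_eq_zero {c : Fin 2 → ((Fin 2 → Fin 2) → ℝ)}
    (hc : PureHarmonic2 c) {s : Fin 2 → Fin 2} (hs : ∀ i, c i s = 0) (j x i : Fin 2) :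
    c i (Function.update s j x) = 0 := by
  have own : c j (Function.update s j x) = 0 := by
    by_cases hx : x = s j
    · rw [hx, Function.update_eq_self, hs j]
    · have h := hc.2 j s
      rwa [Fintype.sum_eq_add x (s j) hx (by omega), Function.update_eq_self, hs j,
        add_zero] at h
  by_cases hij : i = j
  · rw [hij, own]
  · have h := hc.1 (Function.update s j x)
    rwa [Fintype.sum_eq_add i j hij (by omega), own, add_zero] at h

theorem pure_harmonic_2x2_with_nash_is_zero (c : Fin 2 → ((Fin 2 → Fin 2) → ℝ))
    (hc : PureHarmonic2 c) (hnash : ∃ sstar : Fin 2 → Fin 2, IsPureNash2 c sstar) :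
    ∀ (i : Fin 2) (s : Fin 2 → Fin 2), c i s = 0 := by
  obtain ⟨t, ht⟩ := hnash
  intro i s
  have h := hc.update_eq_zero
    (hc.update_eq_zero (hc.eq_zero_of_isPureNash2 ht) 0 (s 0)) 1 (s 1) i
  convert h using 2
  ext j
  fin_cases j <;> simp
end

section
/- Fix n ≥ 1 and k : Fin n → ℕ with 2 ≤ k i for all i. A game c is pure potential (i.e., there exists φ : profiles → ℝ with c i s = φ s − (1/(k i)) · Σ_{x : Fin (k i)} φ (x, s₋ᵢ) for all i and s) if and only if c is both potential and normalized. -/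
/-- A game is normalized if each player's payoffs sum to zero over his own
unilateral deviations. -/
def Normalized {n : ℕ} {k : Fin n → ℕ}
    (c : Fin n → (((i : Fin n) → Fin (k i)) → ℝ)) : Prop :=
  ∀ (i : Fin n) (s : (i : Fin n) → Fin (k i)),
    ∑ x : Fin (k i), c i (Function.update s i x) = 0

/-- A game is pure potential if it is induced by a potential `φ` via
`c i s = φ s − (1/(k i)) · Σ_x φ (x, s₋ᵢ)`. -/
def PurePotential {n : ℕ} {k : Fin n → ℕ}
    (c : Fin n → (((i : Fin n) → Fin (k i)) → ℝ)) : Prop :=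
  ∃ φ : ((i : Fin n) → Fin (k i)) → ℝ,
    ∀ (i : Fin n) (s : (i : Fin n) → Fin (k i)),
      c i s = φ s - (1 / (k i : ℝ)) * ∑ x : Fin (k i), φ (Function.update s i x)

theorem pure_potential_iff_potential_and_normalized (n : ℕ) (hn : 1 ≤ n)
    (k : Fin n → ℕ) (hk : ∀ i, 2 ≤ k i)
    (c : Fin n → (((i : Fin n) → Fin (k i)) → ℝ)) :
    PurePotential c ↔ IsPotentialGame c ∧ Normalized c := by
  have hk0 (i : Fin n) : (k i : ℝ) ≠ 0 := by
    have := hk i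
    exact_mod_cast (by omega : k i ≠ 0)
  constructor
  · rintro ⟨φ, hφ⟩
    refine ⟨⟨φ, fun i x y s => ?_⟩, fun i s => ?_⟩
    · simp only [hφ, Function.update_idem]
      ring
    · simp only [hφ, Function.update_idem, Finset.sum_sub_distrib, Finset.sum_const,
        Finset.card_univ, Fintype.card_fin, nsmul_eq_mul]
      have := hk0 i
      field_simp
      ring
  · rintro ⟨⟨φ, hφ⟩, hc⟩
    refine ⟨φ, fun i s => ?_⟩
    have h : ∑ x : Fin (k i), (c i s - c i (Function.update s i x)) =
        ∑ x : Fin (k i), (φ s - φ (Function.update s i x)) :=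
      Finset.sum_congr rfl fun x _ => by simpa using hφ i (s i) x s
    simp only [Finset.sum_sub_distrib, hc i s, Finset.sum_const, Finset.card_univ,
      Fintype.card_fin, nsmul_eq_mul] at h
    have := hk0 i
    field_simp
    linarith
end

section
/- Fix n ≥ 1 and k : Fin n → ℕ with 2 ≤ k i for all i, and let K = ∏_{i} k i. The harmonic games form a linear subspace of the game space, and its dimension (finrank over ℝ) equals (n − 1)·K + 1. -/
/-- A game is harmonic if, at every profile, the total deviation of payoffs from
their unilateral averages vanishes. -/
def HarmonicGame {n : ℕ} {k : Fin n → ℕ}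
    (c : Fin n → (((i : Fin n) → Fin (k i)) → ℝ)) : Prop :=
  ∀ s : (i : Fin n) → Fin (k i),
    ∑ i : Fin n,
      ((1 / (k i : ℝ)) * (∑ x : Fin (k i), c i (Function.update s i x)) - c i s) = 0

/-- Averaging a function over one coordinate preserves its total. -/
theorem sum_sum_update {n : ℕ} {k : Fin n → ℕ} (i : Fin n)
    (h : ((i : Fin n) → Fin (k i)) → ℝ) :
    ∑ s, ∑ x : Fin (k i), h (Function.update s i x) = k i * ∑ s, h s := by
  have key : ∑ p : ((i : Fin n) → Fin (k i)) × Fin (k i), h (Function.update p.1 i p.2) =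
      ∑ p : ((i : Fin n) → Fin (k i)) × Fin (k i), h p.1 :=
    Finset.sum_nbij' (fun p => (Function.update p.1 i p.2, p.1 i))
      (fun p => (Function.update p.1 i p.2, p.1 i)) (by simp) (by simp) (by simp) (by simp)
      (by simp)
  rw [Fintype.sum_prod_type, Fintype.sum_prod_type] at key
  rw [key, Finset.mul_sum]
  simp

/-- The linear map sending a game to the total deviation of payoffs from their unilateral
averages. -/
noncomputable def totalDeviation {n : ℕ} (k : Fin n → ℕ) :
    (Fin n → (((i : Fin n) → Fin (k i)) → ℝ)) →ₗ[ℝ] (((i : Fin n) → Fin (k i)) → ℝ) where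
  toFun c s := ∑ i : Fin n,
    ((1 / (k i : ℝ)) * (∑ x : Fin (k i), c i (Function.update s i x)) - c i s)
  map_add' c d := by
    ext s
    simp only [Pi.add_apply, ← Finset.sum_add_distrib]
    refine Finset.sum_congr rfl fun i _ => ?_
    rw [Finset.sum_add_distrib]
    ring
  map_smul' r c := by
    ext s
    simp only [Pi.smul_apply, smul_eq_mul, RingHom.id_apply, Finset.mul_sum]
    refine Finset.sum_congr rfl fun i _ => ?_
    rw [mul_sub, Finset.mul_sum]
    congr 1
    exact Finset.sum_congr rfl fun x _ => by ring

/-- The sum of the values of a function on profiles, as a linear functional. -/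
noncomputable def profileSum {n : ℕ} (k : Fin n → ℕ) :
    (((i : Fin n) → Fin (k i)) → ℝ) →ₗ[ℝ] ℝ :=
  ∑ s, LinearMap.proj s

theorem profileSum_apply {n : ℕ} (k : Fin n → ℕ) (f : ((i : Fin n) → Fin (k i)) → ℝ) :
    profileSum k f = ∑ s, f s := by
  simp [profileSum]

theorem sum_single_update {n : ℕ} {k : Fin n → ℕ} (i : Fin n)
    (s t : (i : Fin n) → Fin (k i)) :
    ∑ x : Fin (k i), (Pi.single t (1 : ℝ) : ((i : Fin n) → Fin (k i)) → ℝ)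
      (Function.update s i x) = if Function.update s i (t i) = t then 1 else 0 := by
  rw [Finset.sum_eq_single (t i)]
  · simp [Pi.single_apply]
  · intro x _ hx
    refine Pi.single_eq_of_ne (fun h => hx ?_) _
    rw [← h, Function.update_self]
  · simp

theorem single_update_sub_single_mem_range {n : ℕ} {k : Fin n → ℕ} (i : Fin n)
    (t : (i : Fin n) → Fin (k i)) (y : Fin (k i)) :
    (Pi.single (Function.update t i y) 1 - Pi.single t 1 : ((i : Fin n) → Fin (k i)) → ℝ) ∈
      LinearMap.range (totalDeviation k) := by
  refine ⟨Pi.single i (Pi.single t 1 - Pi.single (Function.update t i y) 1), ?_⟩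
  ext s
  have hiff : Function.update s i y = Function.update t i y ↔
      Function.update s i (t i) = t := by
    constructor
    · intro h
      simpa using congrArg (fun u => Function.update u i (t i)) h
    · intro h
      simpa using congrArg (fun u => Function.update u i y) h
  simp only [totalDeviation, LinearMap.coe_mk, AddHom.coe_mk]
  rw [Finset.sum_eq_single i]
  · simp only [Pi.single_eq_same, Pi.sub_apply, Finset.sum_sub_distrib, sum_single_update,
      Function.update_self, hiff]
    ring
  · intro j _ hj
    simp [Pi.single_eq_of_ne hj]
  · simp

theorem single_sub_single_mem_range {n : ℕ} {k : Fin n → ℕ} (s t : (i : Fin n) → Fin (k i)) :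
    (Pi.single t 1 - Pi.single s 1 : ((i : Fin n) → Fin (k i)) → ℝ) ∈
      LinearMap.range (totalDeviation k) := by
  have key (S : Finset (Fin n)) : (Pi.single (S.piecewise t s) 1 - Pi.single s 1 :
      ((i : Fin n) → Fin (k i)) → ℝ) ∈ LinearMap.range (totalDeviation k) := by
    induction S using Finset.induction_on with
    | empty => simp
    | insert j S _ ih =>
      rw [Finset.piecewise_insert]
      simpa using add_mem (single_update_sub_single_mem_range j (S.piecewise t s) (t j)) ih
  simpa using key Finset.univ

theorem range_totalDeviation {n : ℕ} {k : Fin n → ℕ} (hk : ∀ i, 0 < k i) :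
    LinearMap.range (totalDeviation k) = LinearMap.ker (profileSum k) := by
  apply le_antisymm
  · rintro _ ⟨c, rfl⟩
    rw [LinearMap.mem_ker, profileSum_apply]
    simp only [totalDeviation, LinearMap.coe_mk, AddHom.coe_mk]
    rw [Finset.sum_comm]
    refine Finset.sum_eq_zero fun i _ => ?_
    have : (k i : ℝ) ≠ 0 := by exact_mod_cast (hk i).ne'
    rw [Finset.sum_sub_distrib, ← Finset.mul_sum, sum_sum_update]
    field_simp
    ring
  · intro f hf
    rw [LinearMap.mem_ker, profileSum_apply] at hf
    let t₀ : (i : Fin n) → Fin (k i) := fun i => ⟨0, hk i⟩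
    have hdecomp : f = ∑ t, f t • (Pi.single t 1 - Pi.single t₀ 1 :
        ((i : Fin n) → Fin (k i)) → ℝ) := by
      simp only [smul_sub, Finset.sum_sub_distrib, ← Finset.sum_smul, hf, zero_smul, sub_zero]
      exact pi_eq_sum_univ' f
    rw [hdecomp]
    exact sum_mem fun t _ => Submodule.smul_mem _ _ (single_sub_single_mem_range t₀ t)

theorem finrank_range_totalDeviation {n : ℕ} {k : Fin n → ℕ} (hk : ∀ i, 0 < k i) :
    Module.finrank ℝ (LinearMap.range (totalDeviation k)) + 1 = ∏ i, k i := by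
  have hsurj : LinearMap.range (profileSum k) = ⊤ := by
    rw [LinearMap.range_eq_top]
    intro r
    exact ⟨Pi.single (fun i => ⟨0, hk i⟩) r, by simp [profileSum_apply]⟩
  have h := LinearMap.finrank_range_add_finrank_ker (profileSum k)
  rw [hsurj, finrank_top, Module.finrank_self, Module.finrank_fintype_fun_eq_card] at h
  rw [range_totalDeviation hk, add_comm, h]
  simp

theorem harmonic_subspace_dim (n : ℕ) (hn : 1 ≤ n) (k : Fin n → ℕ)
    (hk : ∀ i, 2 ≤ k i) :
    ∃ H : Submodule ℝ (Fin n → (((i : Fin n) → Fin (k i)) → ℝ)),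
      (∀ c, c ∈ H ↔ HarmonicGame c) ∧
      Module.finrank ℝ H = (n - 1) * (∏ i : Fin n, k i) + 1 := by
  refine ⟨LinearMap.ker (totalDeviation k), fun c => ?_, ?_⟩
  · rw [LinearMap.mem_ker, funext_iff]
    rfl
  · have hrange := finrank_range_totalDeviation fun i => zero_lt_two.trans_le (hk i)
    have h := LinearMap.finrank_range_add_finrank_ker (totalDeviation k)
    have hdim : Module.finrank ℝ (Fin n → (((i : Fin n) → Fin (k i)) → ℝ)) =
        n * ∏ i, k i := by
      simp [Module.finrank_pi_fintype]
    rw [hdim] at h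
    obtain ⟨m, rfl⟩ := Nat.exists_eq_add_of_le' hn
    rw [add_mul, one_mul] at h
    rw [Nat.add_sub_cancel]
    lia
end

section
/- Fix n ≥ 1 and k : Fin n → ℕ with 2 ≤ k i for all i. If c is a harmonic game, then for every player j and every strategy r : Fin (k j), (k j) · Σ over profiles s with s j = r of c j s = Σ over all profiles s of c j s. Consequently, the expected payoff of each player under the uniformly mixed strategy profile is unchanged by any unilateral deviation to a pure strategy, so the uniformly mixed strategy profile is a mixed Nash equilibrium of c. -/
/-- Exchanging the `i`-th coordinate of `s` with `x` permutes the pairs `(s, x)`. -/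
theorem sum_update_swap {ι M : Type*} [Fintype ι] [DecidableEq ι] {α : ι → Type*}
    [∀ i, Fintype (α i)] [AddCommMonoid M] (i : ι) (g : (∀ i, α i) → α i → M) :
    ∑ s, ∑ x, g s x = ∑ s, ∑ x, g (Function.update s i x) (s i) := by
  rw [← Fintype.sum_prod_type', ← Fintype.sum_prod_type']
  have hinv : Function.Involutive
      (fun p : (∀ i, α i) × α i => (Function.update p.1 i p.2, p.1 i)) := by
    intro p
    simp
  exact (Equiv.sum_comp hinv.toPerm (fun p : (∀ i, α i) × α i => g p.1 p.2)).symm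

theorem sum_filter_sum_update {ι M : Type*} [Fintype ι] [DecidableEq ι] {α : ι → Type*}
    [∀ i, Fintype (α i)] [∀ i, DecidableEq (α i)] [AddCommMonoid M] (i j : ι) (r : α j)
    (f : (∀ i, α i) → M) :
    ∑ s with s j = r, ∑ x, f (Function.update s i x) =
      if i = j then ∑ s, f s else Fintype.card (α i) • ∑ s with s j = r, f s := by
  have hswap : ∑ s with s j = r, ∑ x, f (Function.update s i x) =
      ∑ s, ∑ x, if Function.update s i x j = r then f s else 0 := by
    rw [Finset.sum_filter]
    have h := sum_update_swap i
      (fun s x => if s j = r then f (Function.update s i x) else 0)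
    simp only [Function.update_idem, Function.update_eq_self] at h
    rw [← h]
    refine Finset.sum_congr rfl fun s _ => ?_
    split_ifs <;> simp
  rw [hswap]
  split_ifs with hij
  · subst hij
    simp
  · simp [Function.update_of_ne (Ne.symm hij), Finset.sum_filter, Finset.smul_sum]

/-- In a harmonic game, fixing one's own pure strategy does not change one's average payoff
against uniformly mixing opponents. -/
theorem HarmonicGame.card_mul_sum_filter {n : ℕ} {k : Fin n → ℕ} (hk : ∀ i, k i ≠ 0)
    {c : Fin n → (((i : Fin n) → Fin (k i)) → ℝ)} (hc : HarmonicGame c)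
    (j : Fin n) (r : Fin (k j)) :
    (k j : ℝ) * ∑ s with s j = r, c j s = ∑ s, c j s := by
  have hk' : ∀ i, (k i : ℝ) ≠ 0 := fun i => Nat.cast_ne_zero.mpr (hk i)
  have hsum := Finset.sum_eq_zero
    (s := Finset.univ.filter fun s : (i : Fin n) → Fin (k i) => s j = r) fun s _ => hc s
  rw [Finset.sum_comm, Finset.sum_eq_single_of_mem j (Finset.mem_univ j)] at hsum
  · rw [Finset.sum_sub_distrib, ← Finset.mul_sum, sum_filter_sum_update j j r (c j), if_pos rfl,
      sub_eq_zero] at hsum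
    rw [← hsum, ← mul_assoc, mul_one_div_cancel (hk' j), one_mul]
  · intro i _ hij
    rw [Finset.sum_sub_distrib, ← Finset.mul_sum, sum_filter_sum_update i j r (c i), if_neg hij,
      Fintype.card_fin, nsmul_eq_mul, ← mul_assoc, one_div_mul_cancel (hk' i), one_mul, sub_self]

theorem harmonic_uniform_mixed_nash (n : ℕ) (hn : 1 ≤ n) (k : Fin n → ℕ)
    (hk : ∀ i, 2 ≤ k i) (c : Fin n → (((i : Fin n) → Fin (k i)) → ℝ))
    (hc : HarmonicGame c) :
    (∀ (j : Fin n) (r : Fin (k j)),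
      (k j : ℝ) * ∑ s ∈ Finset.univ.filter (fun s : (i : Fin n) → Fin (k i) => s j = r),
          c j s
        = ∑ s : (i : Fin n) → Fin (k i), c j s) ∧
    (∀ (j : Fin n) (r : Fin (k j)),
      (∏ i ∈ Finset.univ.erase j, (1 / (k i : ℝ))) *
          ∑ s ∈ Finset.univ.filter (fun s : (i : Fin n) → Fin (k i) => s j = r), c j s
        ≤ (∏ i : Fin n, (1 / (k i : ℝ))) * ∑ s : (i : Fin n) → Fin (k i), c j s) := by
  have hk' : ∀ i, k i ≠ 0 := fun i => by have := hk i; omega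
  refine ⟨hc.card_mul_sum_filter hk', fun j r => le_of_eq ?_⟩
  have hj : (k j : ℝ) ≠ 0 := Nat.cast_ne_zero.mpr (hk' j)
  rw [← hc.card_mul_sum_filter hk' j r,
    ← Finset.prod_erase_mul _ (fun i => 1 / (k i : ℝ)) (Finset.mem_univ j), mul_assoc,
    ← mul_assoc (1 / (k j : ℝ)), one_div_mul_cancel hj, one_mul]
end

section
/- Fix n ≥ 1 and k : Fin n → ℕ with 2 ≤ k i for all i. Every pure potential game is orthogonal to every nonstrategic game and to every pure harmonic game, and every nonstrategic game is orthogonal to every pure harmonic game (with respect to the inner product ⟨c,d⟩ = Σ_{i,s} (c i s)·(d i s)). Moreover, every game u has a unique decomposition u = u_P + u_N + u_H where u_P is pure potential, u_N is nonstrategic, and u_H is pure harmonic. -/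
/-- The inner product of two games. -/
def gameInner {n : ℕ} {k : Fin n → ℕ}
    (c d : Fin n → (((i : Fin n) → Fin (k i)) → ℝ)) : ℝ :=
  ∑ i : Fin n, ∑ s : (i : Fin n) → Fin (k i), c i s * d i s

/-- Averaging a function of the profile over the strategies of player `i`. -/
noncomputable def ownAverage {n : ℕ} {k : Fin n → ℕ} (i : Fin n) :
    (((i : Fin n) → Fin (k i)) → ℝ) →ₗ[ℝ] (((i : Fin n) → Fin (k i)) → ℝ) where
  toFun f s := (1 / (k i : ℝ)) * ∑ x : Fin (k i), f (Function.update s i x)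
  map_add' f g := by
    ext s
    simp [Finset.sum_add_distrib, mul_add]
  map_smul' r f := by
    ext s
    simp only [Pi.smul_apply, smul_eq_mul, ← Finset.mul_sum, RingHom.id_apply]
    ring

/-- The pure potential game induced by a potential. -/
noncomputable def potentialGame {n : ℕ} {k : Fin n → ℕ} :
    (((i : Fin n) → Fin (k i)) → ℝ) →ₗ[ℝ] (Fin n → (((i : Fin n) → Fin (k i)) → ℝ)) :=
  LinearMap.pi fun i => LinearMap.id - ownAverage i

section

variable {n : ℕ} {k : Fin n → ℕ}

theorem ownAverage_apply (i : Fin n) (f : ((i : Fin n) → Fin (k i)) → ℝ)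
    (s : (i : Fin n) → Fin (k i)) :
    ownAverage i f s = (1 / (k i : ℝ)) * ∑ x : Fin (k i), f (Function.update s i x) :=
  rfl

theorem potentialGame_apply (φ : ((i : Fin n) → Fin (k i)) → ℝ) (i : Fin n) :
    potentialGame φ i = φ - ownAverage i φ :=
  rfl

theorem sum_sum_update_comm (i : Fin n)
    (F : ((i : Fin n) → Fin (k i)) → ((i : Fin n) → Fin (k i)) → ℝ) :
    ∑ s, ∑ x : Fin (k i), F s (Function.update s i x) =
      ∑ s, ∑ x : Fin (k i), F (Function.update s i x) s := by
  rw [← Fintype.sum_prod_type', ← Fintype.sum_prod_type']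
  have hinv : Function.Involutive
      fun z : ((i : Fin n) → Fin (k i)) × Fin (k i) => (Function.update z.1 i z.2, z.1 i) :=
    fun z => by simp
  exact Fintype.sum_equiv hinv.toPerm _ _ fun z => by simp [Function.Involutive.toPerm]

theorem ownAverage_dotProduct (i : Fin n) (f g : ((i : Fin n) → Fin (k i)) → ℝ) :
    ownAverage i f ⬝ᵥ g = f ⬝ᵥ ownAverage i g := by
  have h := sum_sum_update_comm i fun s t => f s * g t
  simp only [dotProduct, ownAverage_apply, mul_assoc, mul_left_comm (f _), ← Finset.mul_sum,
    Finset.sum_mul] at h ⊢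
  rw [h]

theorem purePotential_iff (c : Fin n → (((i : Fin n) → Fin (k i)) → ℝ)) :
    PurePotential c ↔ ∃ φ, potentialGame φ = c := by
  simp only [PurePotential, funext_iff, eq_comm, potentialGame_apply, Pi.sub_apply,
    ownAverage_apply]

theorem ownAverage_update (i : Fin n) (f : ((i : Fin n) → Fin (k i)) → ℝ) (x : Fin (k i))
    (s : (i : Fin n) → Fin (k i)) :
    ownAverage i f (Function.update s i x) = ownAverage i f s := by
  simp [ownAverage_apply]

theorem nonstrategic_iff (hk : ∀ i, k i ≠ 0) (c : Fin n → (((i : Fin n) → Fin (k i)) → ℝ)) :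
    Nonstrategic c ↔ ∀ i, ownAverage i (c i) = c i := by
  constructor
  · intro h i
    ext s
    have hi : (k i : ℝ) ≠ 0 := Nat.cast_ne_zero.mpr (hk i)
    simp [ownAverage_apply, h i _ s, hi]
  · intro h i x s
    rw [← h i, ownAverage_update]

theorem pureHarmonic_iff (hk : ∀ i, k i ≠ 0) (c : Fin n → (((i : Fin n) → Fin (k i)) → ℝ)) :
    PureHarmonic c ↔ ∑ i, c i = 0 ∧ ∀ i, ownAverage i (c i) = 0 := by
  simp [PureHarmonic, funext_iff, ownAverage_apply, hk]

theorem ownAverage_idem (hk : ∀ i, k i ≠ 0) (i : Fin n) (f : ((i : Fin n) → Fin (k i)) → ℝ) :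
    ownAverage i (ownAverage i f) = ownAverage i f :=
  (nonstrategic_iff hk fun j => ownAverage j f).mp (fun j => ownAverage_update j f) i

theorem gameInner_eq (c d : Fin n → (((i : Fin n) → Fin (k i)) → ℝ)) :
    gameInner c d = ∑ i, c i ⬝ᵥ d i :=
  rfl

theorem gameInner_comm (c d : Fin n → (((i : Fin n) → Fin (k i)) → ℝ)) :
    gameInner c d = gameInner d c := by
  simp only [gameInner_eq, dotProduct_comm]

theorem gameInner_add_right (c d e : Fin n → (((i : Fin n) → Fin (k i)) → ℝ)) :
    gameInner c (d + e) = gameInner c d + gameInner c e := by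
  simp [gameInner_eq, Finset.sum_add_distrib]

theorem gameInner_self_eq_zero {c : Fin n → (((i : Fin n) → Fin (k i)) → ℝ)}
    (h : gameInner c c = 0) : c = 0 := by
  rw [gameInner, Finset.sum_eq_zero_iff_of_nonneg fun i _ =>
    Finset.sum_nonneg fun s _ => mul_self_nonneg _] at h
  exact funext fun i => dotProduct_self_eq_zero.mp (h i (Finset.mem_univ i))

/-- The adjoint of `potentialGame`. -/
theorem gameInner_potentialGame (φ : ((i : Fin n) → Fin (k i)) → ℝ)
    (c : Fin n → (((i : Fin n) → Fin (k i)) → ℝ)) :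
    gameInner (potentialGame φ) c = φ ⬝ᵥ ∑ i, (c i - ownAverage i (c i)) := by
  simp only [gameInner_eq, potentialGame_apply, sub_dotProduct, ownAverage_dotProduct,
    dotProduct_sum, dotProduct_sub]

theorem PurePotential.gameInner_nonstrategic (hk : ∀ i, k i ≠ 0)
    {p q : Fin n → (((i : Fin n) → Fin (k i)) → ℝ)}
    (hp : PurePotential p) (hq : Nonstrategic q) : gameInner p q = 0 := by
  obtain ⟨φ, rfl⟩ := (purePotential_iff p).mp hp
  simp [gameInner_potentialGame, (nonstrategic_iff hk q).mp hq]

theorem PurePotential.gameInner_pureHarmonic (hk : ∀ i, k i ≠ 0)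
    {p q : Fin n → (((i : Fin n) → Fin (k i)) → ℝ)}
    (hp : PurePotential p) (hq : PureHarmonic q) : gameInner p q = 0 := by
  obtain ⟨φ, rfl⟩ := (purePotential_iff p).mp hp
  obtain ⟨hsum, havg⟩ := (pureHarmonic_iff hk q).mp hq
  simp [gameInner_potentialGame, hsum, havg]

theorem Nonstrategic.gameInner_pureHarmonic (hk : ∀ i, k i ≠ 0)
    {p q : Fin n → (((i : Fin n) → Fin (k i)) → ℝ)}
    (hp : Nonstrategic p) (hq : PureHarmonic q) : gameInner p q = 0 := by
  refine Finset.sum_eq_zero fun i _ => ?_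
  change p i ⬝ᵥ q i = 0
  rw [← (nonstrategic_iff hk p).mp hp i, ownAverage_dotProduct,
    ((pureHarmonic_iff hk q).mp hq).2 i, dotProduct_zero]

theorem PurePotential.sub {p q : Fin n → (((i : Fin n) → Fin (k i)) → ℝ)}
    (hp : PurePotential p) (hq : PurePotential q) : PurePotential (p - q) := by
  rw [purePotential_iff] at *
  obtain ⟨φ, rfl⟩ := hp
  obtain ⟨ψ, rfl⟩ := hq
  exact ⟨φ - ψ, map_sub _ _ _⟩

theorem Nonstrategic.sub {p q : Fin n → (((i : Fin n) → Fin (k i)) → ℝ)}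
    (hp : Nonstrategic p) (hq : Nonstrategic q) : Nonstrategic (p - q) := fun i x s => by
  simp [hp i x s, hq i x s]

theorem PureHarmonic.sub {p q : Fin n → (((i : Fin n) → Fin (k i)) → ℝ)}
    (hp : PureHarmonic p) (hq : PureHarmonic q) : PureHarmonic (p - q) :=
  ⟨fun s => by simp [hp.1 s, hq.1 s], fun i s => by simp [hp.2 i s, hq.2 i s]⟩

theorem eq_zero_of_add_eq_zero_of_gameInner {c d e : Fin n → (((i : Fin n) → Fin (k i)) → ℝ)}
    (h : c + d + e = 0) (hd : gameInner c d = 0) (he : gameInner c e = 0) : c = 0 := by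
  apply gameInner_self_eq_zero
  have h0 : gameInner c (c + d + e) = 0 := by rw [h]; simp [gameInner]
  rwa [gameInner_add_right, gameInner_add_right, hd, he, add_zero, add_zero] at h0

theorem decomposition_eq_zero (hk : ∀ i, k i ≠ 0)
    {p q r : Fin n → (((i : Fin n) → Fin (k i)) → ℝ)}
    (hp : PurePotential p) (hq : Nonstrategic q) (hr : PureHarmonic r) (h : p + q + r = 0) :
    p = 0 ∧ q = 0 ∧ r = 0 := by
  have hpq := hp.gameInner_nonstrategic hk hq
  have hp0 := eq_zero_of_add_eq_zero_of_gameInner h hpq (hp.gameInner_pureHarmonic hk hr)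
  have hq0 : q = 0 := eq_zero_of_add_eq_zero_of_gameInner (add_comm p q ▸ h)
    (gameInner_comm p q ▸ hpq) (hq.gameInner_pureHarmonic hk hr)
  refine ⟨hp0, hq0, ?_⟩
  simpa [hp0, hq0] using h

/-- Least squares: some `D φ` differs from `u` by a vector orthogonal to the range of `D`. -/
theorem exists_sub_dotProduct_eq_zero {ι V : Type*} [Fintype ι] [AddCommGroup V] [Module ℝ V]
    (D : V →ₗ[ℝ] (ι → ℝ)) (u : ι → ℝ) : ∃ φ, ∀ ψ, D ψ ⬝ᵥ (u - D φ) = 0 := by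
  let E := (WithLp.linearEquiv 2 ℝ (ι → ℝ)).symm
  obtain ⟨y, ⟨φ, hφ⟩, z, hz, huz⟩ :=
    (LinearMap.range (E.toLinearMap ∘ₗ D)).exists_add_mem_mem_orthogonal (E u)
  refine ⟨φ, fun ψ => ?_⟩
  have h := (Submodule.mem_orthogonal _ z).mp hz _ ⟨ψ, rfl⟩
  have hz' : z = E (u - D φ) := by
    rw [map_sub, huz, ← hφ]
    simp
  rw [hz', real_inner_comm] at h
  simpa [E, EuclideanSpace.inner_eq_star_dotProduct, real_inner_comm] using h

theorem exists_potential_gameInner_sub_eq_zero (u : Fin n → (((i : Fin n) → Fin (k i)) → ℝ)) :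
    ∃ φ, ∀ ψ, gameInner (potentialGame ψ) (u - potentialGame φ) = 0 := by
  let C := (LinearEquiv.curry ℝ ℝ (Fin n) ((i : Fin n) → Fin (k i))).symm
  obtain ⟨φ, hφ⟩ := exists_sub_dotProduct_eq_zero (C.toLinearMap ∘ₗ potentialGame) (C u)
  refine ⟨φ, fun ψ => ?_⟩
  rw [← hφ ψ, dotProduct, Fintype.sum_prod_type]
  rfl

theorem exists_decomposition (hk : ∀ i, k i ≠ 0)
    (u : Fin n → (((i : Fin n) → Fin (k i)) → ℝ)) :
    ∃ p q r : Fin n → (((i : Fin n) → Fin (k i)) → ℝ),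
      PurePotential p ∧ Nonstrategic q ∧ PureHarmonic r ∧ u = p + q + r := by
  obtain ⟨φ, hφ⟩ := exists_potential_gameInner_sub_eq_zero u
  set w := u - potentialGame φ with hw
  refine ⟨potentialGame φ, fun i => ownAverage i (w i), fun i => w i - ownAverage i (w i),
    (purePotential_iff _).mpr ⟨φ, rfl⟩, fun i => ownAverage_update i (w i),
    (pureHarmonic_iff hk _).mpr ⟨?_, fun i => ?_⟩, ?_⟩
  · refine dotProduct_self_eq_zero.mp ?_
    rw [← gameInner_potentialGame, hφ]
  · rw [map_sub, ownAverage_idem hk, sub_self]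
  · ext i s
    simp [hw]

end

theorem orthogonal_decomposition (n : ℕ) (hn : 1 ≤ n) (k : Fin n → ℕ)
    (hk : ∀ i, 2 ≤ k i) :
    (∀ p q : Fin n → (((i : Fin n) → Fin (k i)) → ℝ),
      PurePotential p → Nonstrategic q → gameInner p q = 0) ∧
    (∀ p q : Fin n → (((i : Fin n) → Fin (k i)) → ℝ),
      PurePotential p → PureHarmonic q → gameInner p q = 0) ∧
    (∀ p q : Fin n → (((i : Fin n) → Fin (k i)) → ℝ),
      Nonstrategic p → PureHarmonic q → gameInner p q = 0) ∧
    (∀ u : Fin n → (((i : Fin n) → Fin (k i)) → ℝ),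
      ∃! t : (Fin n → (((i : Fin n) → Fin (k i)) → ℝ)) ×
             (Fin n → (((i : Fin n) → Fin (k i)) → ℝ)) ×
             (Fin n → (((i : Fin n) → Fin (k i)) → ℝ)),
        PurePotential t.1 ∧ Nonstrategic t.2.1 ∧ PureHarmonic t.2.2 ∧
          u = t.1 + t.2.1 + t.2.2) := by
  have hk0 : ∀ i, k i ≠ 0 := fun i => by have := hk i; omega
  refine ⟨fun p q hp hq => hp.gameInner_nonstrategic hk0 hq,
    fun p q hp hq => hp.gameInner_pureHarmonic hk0 hq,
    fun p q hp hq => hp.gameInner_pureHarmonic hk0 hq, fun u => ?_⟩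
  obtain ⟨p, q, r, hp, hq, hr, hu⟩ := exists_decomposition hk0 u
  refine ⟨(p, q, r), ⟨hp, hq, hr, hu⟩, ?_⟩
  rintro ⟨p', q', r'⟩ ⟨hp', hq', hr', hu'⟩
  dsimp only at hp' hq' hr' hu'
  have hsum : (p' - p) + (q' - q) + (r' - r) = 0 := by
    rw [show (p' - p) + (q' - q) + (r' - r) = (p' + q' + r') - (p + q + r) by abel, ← hu, ← hu',
      sub_self]
  obtain ⟨h1, h2, h3⟩ := decomposition_eq_zero hk0 (hp'.sub hp) (hq'.sub hq) (hr'.sub hr) hsum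
  rw [sub_eq_zero.mp h1, sub_eq_zero.mp h2, sub_eq_zero.mp h3]
end

section
/- Fix n ≥ 1 and k : Fin n → ℕ with 2 ≤ k i for all i. Let c be a potential game. Define ψ : profiles → ℝ by ψ s = Σ_{i : Fin n} (c i s − (1/(k i)) · Σ_{x : Fin (k i)} c i (x, s₋ᵢ)), and define φ = Σ over all proper subsets S ⊊ Fin n of (1/((n − |S|)·(n choose |S|))) · (Av_S ψ) − (Σ_{i=1}^{n} 1/i) · (Av_{Fin n} ψ). Then φ is a potential function of c: for all i, all x, y : Fin (k i), and all profiles s, c i (x, s₋ᵢ) − c i (y, s₋ᵢ) = φ (x, s₋ᵢ) − φ (y, s₋ᵢ). -/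
/-- The averaging operator `Av_S`: average a function over the coordinates in `S`,
keeping the coordinates outside `S` fixed. -/
noncomputable def Av {n : ℕ} {k : Fin n → ℕ} (S : Finset (Fin n))
    (ψ : ((i : Fin n) → Fin (k i)) → ℝ) : ((i : Fin n) → Fin (k i)) → ℝ :=
  fun s => (1 / ∏ i ∈ S, (k i : ℝ)) *
    ∑ t ∈ Finset.univ.filter (fun t : (i : Fin n) → Fin (k i) => ∀ j ∉ S, t j = s j), ψ t

/-- Averaging over the coordinate `i` and then over `S` is averaging over `insert i S`. -/
lemma Av_coordinate_average {n : ℕ} {k : Fin n → ℕ} (hk : ∀ i, 2 ≤ k i)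
    (P : ((i : Fin n) → Fin (k i)) → ℝ) (S : Finset (Fin n)) (i : Fin n)
    (s : (i : Fin n) → Fin (k i)) :
    Av S (fun t => (1 / (k i : ℝ)) * ∑ x : Fin (k i), P (Function.update t i x)) s =
      Av (insert i S) P s := by
  have hki : (k i : ℝ) ≠ 0 := by
    have := hk i
    exact_mod_cast (by omega : k i ≠ 0)
  unfold Av
  rw [← Finset.mul_sum, ← mul_assoc, ← Finset.sum_product']
  by_cases hi : i ∈ S
  · rw [Finset.insert_eq_of_mem hi]
    have swap : ∑ p ∈ (Finset.univ.filter
          (fun t : (i : Fin n) → Fin (k i) => ∀ j ∉ S, t j = s j)) ×ˢ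
            (Finset.univ : Finset (Fin (k i))), P (Function.update p.1 i p.2) =
        ∑ p ∈ (Finset.univ.filter
          (fun t : (i : Fin n) → Fin (k i) => ∀ j ∉ S, t j = s j)) ×ˢ
            (Finset.univ : Finset (Fin (k i))), P p.1 := by
      have mem : ∀ p ∈ (Finset.univ.filter
          (fun t : (i : Fin n) → Fin (k i) => ∀ j ∉ S, t j = s j)) ×ˢ
            (Finset.univ : Finset (Fin (k i))),
          (Function.update p.1 i p.2, p.1 i) ∈ (Finset.univ.filter
            (fun t : (i : Fin n) → Fin (k i) => ∀ j ∉ S, t j = s j)) ×ˢ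
              (Finset.univ : Finset (Fin (k i))) := by
        intro p hp
        simp only [Finset.mem_product, Finset.mem_filter, Finset.mem_univ, true_and,
          and_true] at hp ⊢
        intro j hj
        rw [Function.update_of_ne (ne_of_mem_of_not_mem hi hj).symm, hp j hj]
      exact Finset.sum_bij' (fun p _ => (Function.update p.1 i p.2, p.1 i))
        (fun p _ => (Function.update p.1 i p.2, p.1 i)) mem mem
        (by simp) (by simp) (by simp)
    rw [swap, Finset.sum_product]
    simp only [Finset.sum_const, Finset.card_univ, Fintype.card_fin, nsmul_eq_mul]
    rw [← Finset.mul_sum]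
    field_simp
  · rw [Finset.prod_insert hi]
    congr 1
    · rw [one_div_mul_one_div, mul_comm]
    · refine Finset.sum_bij' (fun p _ => Function.update p.1 i p.2)
        (fun t _ => (Function.update t i (s i), t i)) ?_ ?_ ?_ ?_ ?_
      · intro p hp
        simp only [Finset.mem_product, Finset.mem_filter, Finset.mem_univ, true_and,
          and_true, Finset.mem_insert, not_or] at hp ⊢
        rintro j ⟨hji, hj⟩
        rw [Function.update_of_ne hji, hp j hj]
      · intro t ht
        simp only [Finset.mem_product, Finset.mem_filter, Finset.mem_univ, true_and,
          and_true, Finset.mem_insert, not_or] at ht ⊢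
        intro j hj
        by_cases hji : j = i
        · subst hji
          simp
        · rw [Function.update_of_ne hji, ht j ⟨hji, hj⟩]
      · rintro ⟨t, x⟩ hp
        simp only [Finset.mem_product, Finset.mem_filter, Finset.mem_univ, true_and,
          and_true] at hp
        simp [← hp i hi]
      · simp
      · simp

lemma Av_empty {n : ℕ} {k : Fin n → ℕ} (P : ((i : Fin n) → Fin (k i)) → ℝ)
    (s : (i : Fin n) → Fin (k i)) : Av ∅ P s = P s := by
  simp [Av, ← funext_iff, Finset.filter_eq']

/-- Reindexing pairs `i ∉ S` by `T = insert i S`. -/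
lemma sum_compl_insert_eq {ι : Type*} [Fintype ι] [DecidableEq ι]
    (w F : Finset ι → ℝ) :
    ∑ S, ∑ i ∈ Sᶜ, w S * F (insert i S) = ∑ T, ∑ i ∈ T, w (T.erase i) * F T := by
  rw [Finset.sum_sigma', Finset.sum_sigma']
  refine Finset.sum_bij' (fun p _ => ⟨insert p.2 p.1, p.2⟩) (fun p _ => ⟨p.1.erase p.2, p.2⟩)
    ?_ ?_ ?_ ?_ ?_
  · simp
  · simp
  · rintro ⟨S, i⟩ h
    simp at h
    simp [h]
  · rintro ⟨S, i⟩ h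
    simp at h
    simp [h]
  · rintro ⟨S, i⟩ h
    simp at h
    simp [h]

/-- The weighted sum of the differences along the edges of the Boolean lattice telescopes. -/
lemma sum_weighted_differences {n : ℕ} (hn : 1 ≤ n) (F : Finset (Fin n) → ℝ) :
    ∑ S : Finset (Fin n), (1 / (((n - S.card) * n.choose S.card : ℕ) : ℝ)) *
      ∑ i ∈ Sᶜ, (F S - F (insert i S)) = F ∅ - F Finset.univ := by
  have expand : ∀ S : Finset (Fin n), (1 / (((n - S.card) * n.choose S.card : ℕ) : ℝ)) *
      ∑ i ∈ Sᶜ, (F S - F (insert i S)) =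
      (if S = Finset.univ then 0 else 1 / (n.choose S.card : ℝ)) * F S -
      ∑ i ∈ Sᶜ, (1 / (((n - S.card) * n.choose S.card : ℕ) : ℝ)) * F (insert i S) := by
    intro S
    rw [Finset.sum_sub_distrib, mul_sub, ← Finset.mul_sum, Finset.sum_const,
      Finset.card_compl, Fintype.card_fin, nsmul_eq_mul]
    congr 1
    split_ifs with h
    · simp [h]
    · have hlt : S.card < n := by
        simpa using Finset.card_lt_univ_of_notMem
          (Classical.choose_spec (not_forall.mp (mt Finset.eq_univ_iff_forall.mpr h)))
      have h1 : ((n - S.card : ℕ) : ℝ) ≠ 0 := by exact_mod_cast (by omega : n - S.card ≠ 0)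
      have h2 : (n.choose S.card : ℝ) ≠ 0 := by exact_mod_cast (Nat.choose_pos hlt.le).ne'
      rw [Nat.cast_mul]
      field_simp
  have collect : ∀ T : Finset (Fin n),
      ∑ i ∈ T, (1 / (((n - (T.erase i).card) * n.choose (T.erase i).card : ℕ) : ℝ)) * F T =
      (if T = ∅ then 0 else 1 / (n.choose T.card : ℝ)) * F T := by
    intro T
    rw [← Finset.sum_mul]
    congr 1
    split_ifs with h
    · simp [h]
    · rw [Finset.sum_congr rfl (fun i hi => by rw [Finset.card_erase_of_mem hi]),
        Finset.sum_const, nsmul_eq_mul]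
      have hle : T.card ≤ n := by simpa using Finset.card_le_univ T
      obtain ⟨t, ht⟩ : ∃ t, T.card = t + 1 :=
        Nat.exists_eq_succ_of_ne_zero (Finset.card_ne_zero.mpr (Finset.nonempty_iff_ne_empty.mpr h))
      rw [ht] at hle ⊢
      rw [Nat.add_sub_cancel, mul_comm (n - t), ← Nat.choose_succ_right_eq]
      have h2 : (n.choose (t + 1) : ℝ) ≠ 0 := by exact_mod_cast (Nat.choose_pos hle).ne'
      have h1 : ((t + 1 : ℕ) : ℝ) ≠ 0 := by positivity
      rw [Nat.cast_mul]
      field_simp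
  have : NeZero n := ⟨by omega⟩
  rw [Finset.sum_congr rfl (fun S _ => expand S), Finset.sum_sub_distrib,
    sum_compl_insert_eq (fun S => 1 / (((n - S.card) * n.choose S.card : ℕ) : ℝ)) F,
    Finset.sum_congr rfl (fun T _ => collect T), ← Finset.sum_sub_distrib]
  have coeff : ∀ T : Finset (Fin n),
      (if T = Finset.univ then 0 else 1 / (n.choose T.card : ℝ)) * F T -
        (if T = ∅ then 0 else 1 / (n.choose T.card : ℝ)) * F T =
      (if T = ∅ then F T else 0) - (if T = Finset.univ then F T else 0) := by
    intro T
    by_cases h0 : T = ∅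
    · subst h0
      simp [Finset.univ_nonempty.ne_empty.symm]
    · by_cases h1 : T = Finset.univ
      · subst h1
        simp [h0]
      · simp [h0, h1]
  rw [Finset.sum_congr rfl (fun T _ => coeff T)]
  simp

/-- `Av S` of the sum of the deviations `P - Av {i} P` in terms of the averages of `P`. -/
lemma Av_sum_deviations {n : ℕ} {k : Fin n → ℕ} (hk : ∀ i, 2 ≤ k i)
    (P : ((i : Fin n) → Fin (k i)) → ℝ) (S : Finset (Fin n)) (s : (i : Fin n) → Fin (k i)) :
    Av S (fun t => ∑ i : Fin n,
      (P t - (1 / (k i : ℝ)) * ∑ x : Fin (k i), P (Function.update t i x))) s =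
      ∑ i ∈ Sᶜ, (Av S P s - Av (insert i S) P s) := by
  have all : Av S (fun t => ∑ i : Fin n,
      (P t - (1 / (k i : ℝ)) * ∑ x : Fin (k i), P (Function.update t i x))) s =
      ∑ i, (Av S P s - Av (insert i S) P s) := by
    simp_rw [← Av_coordinate_average hk P S]
    unfold Av
    rw [Finset.sum_comm, Finset.mul_sum]
    refine Finset.sum_congr rfl (fun i _ => ?_)
    rw [Finset.sum_sub_distrib, mul_sub]
  rw [all]
  refine (Finset.sum_subset (Finset.subset_univ _) (fun i _ hi => ?_)).symm
  rw [Finset.insert_eq_of_mem (by simpa using hi), sub_self]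

theorem potential_function_polynomial_formula (n : ℕ) (hn : 1 ≤ n)
    (k : Fin n → ℕ) (hk : ∀ i, 2 ≤ k i)
    (c : Fin n → (((i : Fin n) → Fin (k i)) → ℝ)) (hc : IsPotentialGame c)
    (ψ : ((i : Fin n) → Fin (k i)) → ℝ)
    (hψ : ∀ s : (i : Fin n) → Fin (k i),
      ψ s = ∑ i : Fin n,
        (c i s - (1 / (k i : ℝ)) * ∑ x : Fin (k i), c i (Function.update s i x)))
    (φ : ((i : Fin n) → Fin (k i)) → ℝ)
    (hφ : ∀ s : (i : Fin n) → Fin (k i),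
      φ s = (∑ S ∈ Finset.univ.filter (fun S : Finset (Fin n) => S ≠ Finset.univ),
          (1 / (((n - S.card) * n.choose S.card : ℕ) : ℝ)) * Av S ψ s)
        - (∑ i ∈ Finset.Icc 1 n, (1 : ℝ) / (i : ℝ)) * Av Finset.univ ψ s) :
    ∀ (i : Fin n) (x y : Fin (k i)) (s : (i : Fin n) → Fin (k i)),
      c i (Function.update s i x) - c i (Function.update s i y) =
        φ (Function.update s i x) - φ (Function.update s i y) := by
  obtain ⟨P, hP⟩ := hc
  have ψ_eq : ψ = fun t => ∑ i : Fin n,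
      (P t - (1 / (k i : ℝ)) * ∑ x : Fin (k i), P (Function.update t i x)) := by
    funext t
    rw [hψ]
    refine Finset.sum_congr rfl (fun i _ => ?_)
    have hki : (k i : ℝ) ≠ 0 := by
      have := hk i
      exact_mod_cast (by omega : k i ≠ 0)
    have dev : ∑ x : Fin (k i), (c i t - c i (Function.update t i x)) =
        ∑ x : Fin (k i), (P t - P (Function.update t i x)) :=
      Finset.sum_congr rfl (fun x _ => by simpa using hP i (t i) x t)
    simp only [Finset.sum_sub_distrib, Finset.sum_const, Finset.card_univ, Fintype.card_fin,
      nsmul_eq_mul] at dev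
    field_simp
    linarith
  have φ_eq : ∀ s, φ s = P s - Av Finset.univ P s := by
    intro s
    have univ_zero : Av Finset.univ ψ s = 0 := by
      rw [ψ_eq, Av_sum_deviations hk]
      simp
    rw [hφ, univ_zero, mul_zero, sub_zero, ← Av_empty P s,
      ← sum_weighted_differences hn (fun S => Av S P s)]
    rw [Finset.sum_subset (Finset.subset_univ _)]
    · exact Finset.sum_congr rfl (fun S _ => by rw [ψ_eq, Av_sum_deviations hk])
    · intro S _ hS
      have hS' : S = Finset.univ := by simpa using hS
      rw [hS', univ_zero, mul_zero]
  intro i x y s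
  rw [hP, φ_eq, φ_eq]
  simp [Av]
end
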